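/- Let w̲ ∈ (0, 1/2] and c ∈ (0, 1]. There exists a constant C > 0, depending only on n, α, a, c and w̲, such that the following holds. Under the standing assumptions with b = 0, if at every (x,t) with ψ(x,t) > 0 one has w(x,t) ≥ 2·w̲ and c ≤ (1/2)·(H[u(·,t)](x))^α ≤ c⁻¹, then at every (x,t) ∈ U × [0,T] with ψ(x,t) > 0 one has ψ(x,t)·|A[u(·,t)]|(x) ≤ C · max{ sup{ ψ(y,0)·|A[u(·,0)]|(y) : y ∈ U, ψ(y,0) > 0 }, 1 }. -/

import Mathlib

noncomputable section
open Set

abbrev En (n : ℕ) := EuclideanSpace ℝ (Fin n)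

/-- Partial derivative `∂ᵢ f` at `x`. -/
noncomputable def pd {n : ℕ} (f : En n → ℝ) (i : Fin n) (x : En n) : ℝ :=
  fderiv ℝ f x (EuclideanSpace.single i 1)

/-- `|∇f|²` at `x`. -/
noncomputable def gradNormSq {n : ℕ} (f : En n → ℝ) (x : En n) : ℝ :=
  ∑ i : Fin n, (pd f i x) ^ 2

/-- `v(f) = √(1+|∇f|²)`. -/
noncomputable def graphV {n : ℕ} (f : En n → ℝ) (x : En n) : ℝ :=
  Real.sqrt (1 + gradNormSq f x)

/-- Mean curvature `H[f] = div(∇f / v(f))` of `graph f`. -/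
noncomputable def meanCurv {n : ℕ} (f : En n → ℝ) (x : En n) : ℝ :=
  ∑ i : Fin n, pd (fun y => pd f i y / graphV f y) i x


/-- The localization function `ψ(x,t) = (a − b·t − u(x,t))₊`. -/
noncomputable def psiF {n : ℕ} (a b : ℝ) (u : En n → ℝ → ℝ) (x : En n) (t : ℝ) : ℝ :=
  max (a - b * t - u x t) 0

/-- `w(x,t) = (1+|∇u(x,t)|²)^{-1/2}`. -/
noncomputable def wF {n : ℕ} (u : En n → ℝ → ℝ) (x : En n) (t : ℝ) : ℝ :=
  1 / Real.sqrt (1 + gradNormSq (fun y => u y t) x)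

/-- The inverse induced metric `g^{ij} = δ_{ij} − ∂ᵢf·∂ⱼf/(1+|∇f|²)`. -/
noncomputable def ginv {n : ℕ} (f : En n → ℝ) (i j : Fin n) (x : En n) : ℝ :=
  (if i = j then (1:ℝ) else 0) - pd f i x * pd f j x / (1 + gradNormSq f x)

/-- The second fundamental form `h_{ij} = ∂ᵢ∂ⱼf / v(f)`. -/
noncomputable def sff {n : ℕ} (f : En n → ℝ) (i j : Fin n) (x : En n) : ℝ :=
  pd (fun y => pd f j y) i x / graphV f x

/-- The norm `|A[f]|` of the second fundamental form of `graph f`. -/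
noncomputable def normA {n : ℕ} (f : En n → ℝ) (x : En n) : ℝ :=
  Real.sqrt (∑ i : Fin n, ∑ j : Fin n, ∑ k : Fin n, ∑ l : Fin n,
    ginv f i k x * ginv f j l x * sff f i j x * sff f k l x)

section part1
namespace LCB
open Filter Topology
open scoped ContDiff

/-- Two-jet of a real function at `0`. -/
def Jet2 (f : ℝ → ℝ) (a b c : ℝ) : Prop :=
  f 0 = a ∧ ∃ f' : ℝ → ℝ, (∀ᶠ s in 𝓝 (0:ℝ), HasDerivAt f (f' s) s) ∧ f' 0 = b ∧ HasDerivAt f' c 0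

theorem Jet2.const (a : ℝ) : Jet2 (fun _ => a) a 0 0 :=
  ⟨rfl, fun _ => 0, Eventually.of_forall fun s => hasDerivAt_const s a, rfl, hasDerivAt_const _ _⟩

theorem Jet2.ident : Jet2 (fun s => s) 0 1 0 :=
  ⟨rfl, fun _ => 1, Eventually.of_forall fun s => hasDerivAt_id s, rfl, hasDerivAt_const _ _⟩

theorem Jet2.add {f g : ℝ → ℝ} {a b c a' b' c' : ℝ} (hf : Jet2 f a b c) (hg : Jet2 g a' b' c') :
    Jet2 (fun s => f s + g s) (a + a') (b + b') (c + c') := by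
  obtain ⟨h0, f', h1, h2, h3⟩ := hf
  obtain ⟨k0, g', k1, k2, k3⟩ := hg
  refine ⟨by simp [h0, k0], fun s => f' s + g' s, ?_, by simp [h2, k2], h3.add k3⟩
  filter_upwards [h1, k1] with s hs ks using hs.add ks

theorem Jet2.neg {f : ℝ → ℝ} {a b c : ℝ} (hf : Jet2 f a b c) :
    Jet2 (fun s => - f s) (-a) (-b) (-c) := by
  obtain ⟨h0, f', h1, h2, h3⟩ := hf
  refine ⟨by simp [h0], fun s => - f' s, ?_, by simp [h2], h3.neg⟩
  filter_upwards [h1] with s hs using hs.neg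

theorem Jet2.sub {f g : ℝ → ℝ} {a b c a' b' c' : ℝ} (hf : Jet2 f a b c) (hg : Jet2 g a' b' c') :
    Jet2 (fun s => f s - g s) (a - a') (b - b') (c - c') := by
  simpa [sub_eq_add_neg] using hf.add hg.neg

theorem Jet2.mul {f g : ℝ → ℝ} {a b c a' b' c' : ℝ} (hf : Jet2 f a b c) (hg : Jet2 g a' b' c') :
    Jet2 (fun s => f s * g s) (a * a') (b * a' + a * b') (c * a' + 2 * b * b' + a * c') := by
  obtain ⟨h0, f', h1, h2, h3⟩ := hf
  obtain ⟨k0, g', k1, k2, k3⟩ := hg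
  have hf0 := h1.self_of_nhds
  have hg0 := k1.self_of_nhds
  refine ⟨by simp [h0, k0], fun s => f' s * g s + f s * g' s, ?_, by simp [h0, h2, k0, k2], ?_⟩
  · filter_upwards [h1, k1] with s hs ks using hs.mul ks
  · refine ((h3.mul hg0).add (hf0.mul k3)).congr_deriv ?_
    rw [h0, h2, k0, k2]; ring

theorem Jet2.sum {ι : Type*} (t : Finset ι) {f : ι → ℝ → ℝ} {a b c : ι → ℝ}
    (hf : ∀ i, Jet2 (f i) (a i) (b i) (c i)) :
    Jet2 (fun s => ∑ i ∈ t, f i s) (∑ i ∈ t, a i) (∑ i ∈ t, b i) (∑ i ∈ t, c i) := by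
  classical
  induction t using Finset.induction_on with
  | empty => simpa using Jet2.const 0
  | insert i t hi ih =>
    simp only [Finset.sum_insert hi]
    exact (hf i).add ih

theorem Jet2.comp {f g g' : ℝ → ℝ} {a b c g'' : ℝ} (hf : Jet2 f a b c)
    (hg : ∀ᶠ y in 𝓝 a, HasDerivAt g (g' y) y) (hg' : HasDerivAt g' g'' a) :
    Jet2 (fun s => g (f s)) (g a) (g' a * b) (g'' * b ^ 2 + g' a * c) := by
  obtain ⟨h0, f', h1, h2, h3⟩ := hf
  have hf0 := h1.self_of_nhds
  subst h0
  refine ⟨rfl, fun s => g' (f s) * f' s, ?_, by simp [h2], ?_⟩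
  · filter_upwards [h1, hf0.continuousAt.eventually hg] with s hs ks
    exact ks.comp s hs
  · refine ((hg'.comp (0:ℝ) hf0).mul h3).congr_deriv ?_
    simp only [Function.comp, h2]; ring

theorem Jet2.inv {f : ℝ → ℝ} {a b c : ℝ} (hf : Jet2 f a b c) (ha : a ≠ 0) :
    Jet2 (fun s => (f s)⁻¹) (a⁻¹) (-b / a ^ 2) (2 * b ^ 2 / a ^ 3 - c / a ^ 2) := by
  have := hf.comp (g := fun y => y⁻¹) (g' := fun y => -(y ^ 2)⁻¹) (g'' := 2 / a ^ 3) ?_ ?_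
  · convert this using 1 <;> field_simp
    ring
  · filter_upwards [isOpen_ne.mem_nhds ha] with y hy using hasDerivAt_inv hy
  · refine (((hasDerivAt_pow 2 a).inv (pow_ne_zero 2 ha)).neg).congr_deriv ?_
    field_simp; simp [mul_comm]

theorem Jet2.log {f : ℝ → ℝ} {a b c : ℝ} (hf : Jet2 f a b c) (ha : 0 < a) :
    Jet2 (fun s => Real.log (f s)) (Real.log a) (b / a) (c / a - (b / a) ^ 2) := by
  have := hf.comp (g := Real.log) (g' := fun y => y⁻¹) (g'' := -(a ^ 2)⁻¹) ?_
    (hasDerivAt_inv ha.ne')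
  · convert this using 1 <;> field_simp
    ring
  · filter_upwards [isOpen_ne.mem_nhds ha.ne'] with y hy using Real.hasDerivAt_log hy

theorem Jet2.rpow {f : ℝ → ℝ} {a b c : ℝ} (hf : Jet2 f a b c) (ha : 0 < a) (p : ℝ) :
    Jet2 (fun s => (f s) ^ p) (a ^ p) (p * a ^ (p - 1) * b)
      (p * (p - 1) * a ^ (p - 2) * b ^ 2 + p * a ^ (p - 1) * c) := by
  refine hf.comp (g := fun y => y ^ p) (g' := fun y => p * y ^ (p - 1)) ?_ ?_
  · filter_upwards [isOpen_ne.mem_nhds ha.ne'] with y hy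
    exact Real.hasDerivAt_rpow_const (Or.inl hy)
  · refine ((Real.hasDerivAt_rpow_const (p := p - 1) (Or.inl ha.ne')).const_mul p).congr_deriv ?_
    rw [show p - 1 - 1 = p - 2 by ring]; ring

theorem Jet2.congr {f g : ℝ → ℝ} {a b c : ℝ} (hf : Jet2 f a b c) (h : f =ᶠ[𝓝 0] g) :
    Jet2 g a b c := by
  obtain ⟨h0, f', h1, h2, h3⟩ := hf
  refine ⟨by rw [← h.self_of_nhds, h0], f', ?_, h2, h3⟩
  filter_upwards [h1, h.eventually_nhds] with s hs ks
  have ks' : f =ᶠ[𝓝 s] g := ks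
  exact hs.congr_of_eventuallyEq ks'.symm

theorem Jet2.unique {f : ℝ → ℝ} {a b c a' b' c' : ℝ} (hf : Jet2 f a b c) (hg : Jet2 f a' b' c') :
    a = a' ∧ b = b' ∧ c = c' := by
  obtain ⟨h0, f', h1, h2, h3⟩ := hf
  obtain ⟨k0, g', k1, k2, k3⟩ := hg
  have e : f' =ᶠ[𝓝 0] g' := by
    filter_upwards [h1, k1] with s hs ks using hs.unique ks
  exact ⟨h0 ▸ k0, by rw [← h2, ← k2, e.self_of_nhds], (h3.congr_of_eventuallyEq e.symm).unique k3⟩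

theorem Jet2.hasDerivAt {f : ℝ → ℝ} {a b c : ℝ} (hf : Jet2 f a b c) : HasDerivAt f b 0 := by
  obtain ⟨h0, f', h1, h2, h3⟩ := hf
  exact h2 ▸ h1.self_of_nhds

/-- second derivative test at a local maximum -/
theorem Jet2.max {f : ℝ → ℝ} {a b c : ℝ} (hf : Jet2 f a b c) (hm : IsLocalMax f 0) :
    b = 0 ∧ c ≤ 0 := by
  have hb : b = 0 := hm.hasDerivAt_eq_zero hf.hasDerivAt
  refine ⟨hb, ?_⟩
  obtain ⟨h0, f', h1, h2, h3⟩ := hf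
  by_contra hc
  push Not at hc
  have hd : deriv f =ᶠ[𝓝 0] f' := by
    filter_upwards [h1] with s hs using hs.deriv
  have hdd : deriv (deriv f) 0 = c := by rw [hd.deriv_eq, h3.deriv]
  have hmin : IsLocalMin f 0 := isLocalMin_of_deriv_deriv_pos (by rw [hdd]; exact hc)
    (by rw [hd.self_of_nhds, h2, hb]) h1.self_of_nhds.continuousAt
  have hconst : ∀ᶠ s in 𝓝 (0:ℝ), f s = f 0 := by
    filter_upwards [hm, hmin] with s h1 h2 using le_antisymm h1 h2
  have e1 : deriv f =ᶠ[𝓝 0] fun _ => 0 := by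
    filter_upwards [hconst.eventually_nhds] with s hs
    have : f =ᶠ[𝓝 s] fun _ => f 0 := hs
    rw [this.deriv_eq]; simp
  have := e1.deriv_eq
  simp [hdd] at this
  exact hc.ne' this

section D
variable {Z : Type*} [NormedAddCommGroup Z] [NormedSpace ℝ Z]

/-- directional derivative -/
def D (e : Z) (G : Z → ℝ) : Z → ℝ := fun z => fderiv ℝ G z e

theorem D_smooth {W : Set Z} (hW : IsOpen W) {G : Z → ℝ} (hG : ContDiffOn ℝ ∞ G W) (e : Z) :
    ContDiffOn ℝ ∞ (D e G) W :=
  (hG.fderiv_of_isOpen hW (by simp)).clm_apply contDiffOn_const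

theorem D_comm {W : Set Z} (hW : IsOpen W) {G : Z → ℝ} (hG : ContDiffOn ℝ ∞ G W) (d e : Z)
    {z : Z} (hz : z ∈ W) : D d (D e G) z = D e (D d G) z := by
  have hc : ContDiffAt ℝ ∞ G z := hG.contDiffAt (hW.mem_nhds hz)
  have hs : IsSymmSndFDerivAt ℝ G z := hc.isSymmSndFDerivAt (by
    simp only [minSmoothness_of_isRCLikeNormedField]; exact WithTop.coe_le_coe.2 le_top)
  have hd : DifferentiableAt ℝ (fderiv ℝ G) z :=
    (hc.fderiv_right (m := ∞) (by simp)).differentiableAt (by simp)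
  have key : ∀ a b : Z, D a (D b G) z = fderiv ℝ (fderiv ℝ G) z a b := by
    intro a b
    unfold D
    rw [fderiv_clm_apply hd (differentiableAt_const b)]
    simp
  rw [key, key, hs.eq]

theorem D_congr {W : Set Z} (hW : IsOpen W) {G K : Z → ℝ} (h : EqOn G K W) (d : Z) :
    EqOn (D d G) (D d K) W := by
  intro z hz
  have : G =ᶠ[𝓝 z] K := by
    filter_upwards [hW.mem_nhds hz] with y hy using h hy
  unfold D
  rw [this.fderiv_eq]

theorem line_hasDerivAt {W : Set Z} (hW : IsOpen W) {G : Z → ℝ} (hG : ContDiffOn ℝ ∞ G W)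
    (z d : Z) (s : ℝ) (hs : z + s • d ∈ W) :
    HasDerivAt (fun r : ℝ => G (z + r • d)) (D d G (z + s • d)) s := by
  have h1 : HasFDerivAt G (fderiv ℝ G (z + s • d)) (z + s • d) :=
    ((hG.contDiffAt (hW.mem_nhds hs)).differentiableAt (by simp)).hasFDerivAt
  have h2 : HasDerivAt (fun r : ℝ => z + r • d) d s := by
    simpa using ((hasDerivAt_id s).smul_const d).const_add z
  exact h1.comp_hasDerivAt s h2

theorem line_mem {W : Set Z} (hW : IsOpen W) {z : Z} (hz : z ∈ W) (d : Z) :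
    ∀ᶠ s in 𝓝 (0:ℝ), z + s • d ∈ W := by
  have : ContinuousAt (fun s : ℝ => z + s • d) 0 := by fun_prop
  exact this.eventually (by simpa using hW.mem_nhds hz)

theorem line_jet {W : Set Z} (hW : IsOpen W) {G : Z → ℝ} (hG : ContDiffOn ℝ ∞ G W)
    {z : Z} (hz : z ∈ W) (d : Z) :
    Jet2 (fun s : ℝ => G (z + s • d)) (G z) (D d G z) (D d (D d G) z) := by
  refine ⟨by simp, fun s => D d G (z + s • d), ?_, by simp, ?_⟩
  · filter_upwards [line_mem hW hz d] with s hs using line_hasDerivAt hW hG z d s hs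
  · simpa using line_hasDerivAt hW (D_smooth hW hG d) z d 0 (by simpa using hz)

theorem D_add (d e : Z) (G : Z → ℝ) (z : Z) : D (d + e) G z = D d G z + D e G z := by
  simp [D]
theorem D_smul (c : ℝ) (e : Z) (G : Z → ℝ) (z : Z) : D (c • e) G z = c * D e G z := by
  simp [D]
theorem D_sum {ι : Type*} (t : Finset ι) (c : ι → ℝ) (e : ι → Z) (G : Z → ℝ) (z : Z) :
    D (∑ i ∈ t, c i • e i) G z = ∑ i ∈ t, c i * D (e i) G z := by
  simp [D]
end D

end LCB
end part1

section part2
namespace LCB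
open Filter Topology
open scoped ContDiff

section Ejets
set_option linter.unusedSectionVars false
variable {Z : Type*} [NormedAddCommGroup Z] [NormedSpace ℝ Z]

theorem D3_comm {W : Set Z} (hW : IsOpen W) {F : Z → ℝ} (hF : ContDiffOn ℝ ∞ F W)
    (d a b : Z) : EqOn (D d (D a (D b F))) (D a (D b (D d F))) W := by
  intro z hz
  rw [D_comm hW (D_smooth hW hF b) d a hz]
  exact D_congr hW (fun y hy => D_comm hW hF d b hy) a hz

theorem D4_comm {W : Set Z} (hW : IsOpen W) {F : Z → ℝ} (hF : ContDiffOn ℝ ∞ F W)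
    (d a b : Z) : EqOn (D d (D d (D a (D b F)))) (D a (D b (D d (D d F)))) W := by
  intro z hz
  rw [D_congr hW (D3_comm hW hF d a b) d hz]
  exact D3_comm hW (D_smooth hW hF d) d a b hz

theorem D21_comm {W : Set Z} (hW : IsOpen W) {F : Z → ℝ} (hF : ContDiffOn ℝ ∞ F W)
    (d a : Z) : EqOn (D d (D d (D a F))) (D a (D d (D d F))) W := by
  intro z hz
  rw [D_congr hW (fun y hy => D_comm hW hF d a hy) d hz]
  exact D_comm hW (D_smooth hW hF d) d a hz

/-- contraction of the Hessian with two vectors -/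
theorem hess_contract {W : Set Z} (hW : IsOpen W) {G : Z → ℝ} (hG : ContDiffOn ℝ ∞ G W)
    {z : Z} (hz : z ∈ W) {ι : Type*} [Fintype ι] (e : ι → Z) (x y : ι → ℝ) :
    ∑ A, ∑ B, x A * y B * D (e A) (D (e B) G) z
      = D (∑ A, x A • e A) (D (∑ B, y B • e B) G) z := by
  rw [D_sum]
  refine Finset.sum_congr rfl fun A _ => ?_
  rw [D_comm hW hG _ _ hz, D_sum, Finset.mul_sum]
  refine Finset.sum_congr rfl fun B _ => ?_
  rw [D_comm hW hG _ _ hz]; ring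

theorem hess_add_right {W : Set Z} (hW : IsOpen W) {G : Z → ℝ} (hG : ContDiffOn ℝ ∞ G W)
    {z : Z} (hz : z ∈ W) (a b c : Z) :
    D a (D (b + c) G) z = D a (D b G) z + D a (D c G) z := by
  rw [D_comm hW hG _ _ hz, D_add, D_comm hW hG b _ hz, D_comm hW hG c _ hz]

theorem hess_smul_right {W : Set Z} (hW : IsOpen W) {G : Z → ℝ} (hG : ContDiffOn ℝ ∞ G W)
    {z : Z} (hz : z ∈ W) (a b : Z) (r : ℝ) :
    D a (D (r • b) G) z = r * D a (D b G) z := by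
  rw [D_comm hW hG _ _ hz, D_smul, D_comm hW hG b _ hz]

/-- The frame with the extra vector. -/
def fr {n : ℕ} (e : Fin n → Z) (e0 : Z) : Option (Fin n) → Z := fun o => o.elim e0 e

@[simp] theorem fr_none {n : ℕ} (e : Fin n → Z) (e0 : Z) : fr e e0 none = e0 := rfl
@[simp] theorem fr_some {n : ℕ} (e : Fin n → Z) (e0 : Z) (i : Fin n) :
    fr e e0 (some i) = e i := rfl

/-- Raw jets of `v` and `E = v H`. -/
theorem raw_jets {n : ℕ} {W : Set Z} (hW : IsOpen W) {F v H : Z → ℝ}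
    (hF : ContDiffOn ℝ ∞ F W) (hv : ContDiffOn ℝ ∞ v W) (hH : ContDiffOn ℝ ∞ H W)
    (e : Fin n → Z) (e0 : Z)
    (hV : ∀ z ∈ W, v z ^ 2 = 1 + ∑ A, (D (fr e e0 A) F z) ^ 2)
    (hE : ∀ z ∈ W, v z * H z * v z ^ 2 =
      v z ^ 2 * (∑ A, D (fr e e0 A) (D (fr e e0 A) F) z) -
      ∑ A, ∑ B, D (fr e e0 A) F z * D (fr e e0 B) F z * D (fr e e0 A) (D (fr e e0 B) F) z)
    {z : Z} (hz : z ∈ W) (hvz : 0 < v z)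
    (hP : ∑ A, D (fr e e0 A) F z • fr e e0 A = v z • e0) (d : Z) :
    D d v z = D e0 (D d F) z ∧
    v z * D d (D d v) z + (D d v z) ^ 2 =
      ∑ b, (D (e b) (D d F) z) ^ 2 + (D e0 (D d F) z) ^ 2 + v z * D e0 (D d (D d F)) z ∧
    v z * H z = ∑ a, D (e a) (D (e a) F) z ∧
    D d v z * H z + v z * D d H z = ∑ a, D (e a) (D (e a) (D d F)) z
      - 2 / v z * ∑ b, D (e b) (D d F) z * D (e b) (D e0 F) z ∧
    (D d (D d v) z * H z + 2 * D d v z * D d H z + v z * D d (D d H) z) * v z ^ 2 =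
      v z ^ 2 * ∑ a, D (e a) (D (e a) (D d (D d F))) z
      - 2 * v z * ∑ b, D (e b) (D d (D d F)) z * D (e b) (D e0 F) z
      + 2 * D e0 (D e0 F) z * (∑ b, (D (e b) (D d F) z) ^ 2 + (D e0 (D d F) z) ^ 2)
      + 8 * D e0 (D d F) z * ∑ b, D (e b) (D d F) z * D (e b) (D e0 F) z
      - 2 * (∑ b, ∑ c, D (e b) (D d F) z * D (e c) (D d F) z * D (e b) (D (e c) F) z
          + 2 * D e0 (D d F) z * (∑ b, D (e b) (D d F) z * D (e b) (D e0 F) z)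
          + (D e0 (D d F) z) ^ 2 * D e0 (D e0 F) z)
      - 4 * v z * ∑ b, D (e b) (D d F) z * D (e b) (D e0 (D d F)) z := by
  have hG1 := D_smooth hW hF d
  have hG2 := D_smooth hW hG1 d
  have jv := line_jet hW hv hz d
  have jH := line_jet hW hH hz d
  -- first order partials
  have ju : ∀ A : Option (Fin n), Jet2 (fun s : ℝ => D (fr e e0 A) F (z + s • d))
      (D (fr e e0 A) F z) (D (fr e e0 A) (D d F) z) (D (fr e e0 A) (D d (D d F)) z) := by
    intro A
    have := line_jet hW (D_smooth hW hF (fr e e0 A)) hz d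
    rwa [D21_comm hW hF d _ hz, D_comm hW hF d _ hz] at this
  have juu : ∀ A B : Option (Fin n),
      Jet2 (fun s : ℝ => D (fr e e0 A) (D (fr e e0 B) F) (z + s • d))
      (D (fr e e0 A) (D (fr e e0 B) F) z) (D (fr e e0 A) (D (fr e e0 B) (D d F)) z)
      (D (fr e e0 A) (D (fr e e0 B) (D d (D d F))) z) := by
    intro A B
    have := line_jet hW (D_smooth hW (D_smooth hW hF (fr e e0 B)) (fr e e0 A)) hz d
    rwa [D4_comm hW hF d _ _ hz, D3_comm hW hF d _ _ hz] at this
  have mem := line_mem hW hz d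
  -- V
  have jV := (Jet2.sum Finset.univ fun A => (ju A).mul (ju A))
  have jV1 := (Jet2.const 1).add jV
  have jvv := jv.mul jv
  have eV := (jvv.congr (g := fun s => 1 + ∑ A, D (fr e e0 A) F (z + s • d) *
      D (fr e e0 A) F (z + s • d)) (by
    filter_upwards [mem] with s hs
    have := hV _ hs
    simp only [pow_two] at this
    exact this)).unique jV1
  -- S, N
  have jS := Jet2.sum Finset.univ fun A => juu A A
  have jN := Jet2.sum Finset.univ fun A => Jet2.sum Finset.univ fun B =>
    ((ju A).mul (ju B)).mul (juu A B)
  have jR := (jvv.mul jS).sub jN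
  have jL := (jv.mul jH).mul jvv
  have eE := (jL.congr (by
    filter_upwards [mem] with s hs
    have := hE _ hs
    simp only [pow_two] at this
    exact this)).unique jR
  -- contractions
  set x0 := fun A => D (fr e e0 A) F z with hx0
  set x1 := fun A => D (fr e e0 A) (D d F) z with hx1
  set x2 := fun A => D (fr e e0 A) (D d (D d F)) z with hx2
  have c01 : ∑ A, x0 A * x1 A = v z * D e0 (D d F) z := by
    rw [← D_smul, ← hP, D_sum]
  have c02 : ∑ A, x0 A * x2 A = v z * D e0 (D d (D d F)) z := by
    rw [← D_smul, ← hP, D_sum]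
  have K : ∀ (G : Z → ℝ), ContDiffOn ℝ ∞ G W → ∀ y : Option (Fin n) → ℝ,
      ∑ A, ∑ B, y A * x0 B * D (fr e e0 A) (D (fr e e0 B) G) z =
        v z * ∑ A, y A * D (fr e e0 A) (D e0 G) z := by
    intro G hG y
    rw [hess_contract hW hG hz (fr e e0) y x0, hP, D_sum, Finset.mul_sum]
    refine Finset.sum_congr rfl fun A _ => ?_
    rw [hess_smul_right hW hG hz]; ring
  have K' : ∀ (G : Z → ℝ), ContDiffOn ℝ ∞ G W → ∀ y : Option (Fin n) → ℝ,
      ∑ A, ∑ B, x0 A * y B * D (fr e e0 A) (D (fr e e0 B) G) z =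
        v z * ∑ A, y A * D (fr e e0 A) (D e0 G) z := by
    intro G hG y
    rw [← K G hG, Finset.sum_comm]
    refine Finset.sum_congr rfl fun A _ => Finset.sum_congr rfl fun B _ => ?_
    rw [D_comm hW hG _ _ hz]; ring
  have K0 : ∀ (G : Z → ℝ), ContDiffOn ℝ ∞ G W →
      ∑ A, ∑ B, x0 A * x0 B * D (fr e e0 A) (D (fr e e0 B) G) z =
        v z ^ 2 * D e0 (D e0 G) z := by
    intro G hG
    rw [K G hG x0, ← D_sum, hP, D_smul]; ring
  have N1 : ∑ A, ∑ B, ((x1 A * x0 B + x0 A * x1 B) * D (fr e e0 A) (D (fr e e0 B) F) z +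
        x0 A * x0 B * D (fr e e0 A) (D (fr e e0 B) (D d F)) z) =
      2 * v z * (∑ A, x1 A * D (fr e e0 A) (D e0 F) z) + v z ^ 2 * D e0 (D e0 (D d F)) z := by
    simp only [add_mul, Finset.sum_add_distrib]
    rw [K F hF x1, K' F hF x1, K0 _ hG1]; ring
  have N2 : ∑ A, ∑ B, ((x2 A * x0 B + 2 * x1 A * x1 B + x0 A * x2 B) *
          D (fr e e0 A) (D (fr e e0 B) F) z +
        2 * (x1 A * x0 B + x0 A * x1 B) * D (fr e e0 A) (D (fr e e0 B) (D d F)) z +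
        x0 A * x0 B * D (fr e e0 A) (D (fr e e0 B) (D d (D d F))) z) =
      2 * v z * (∑ A, x2 A * D (fr e e0 A) (D e0 F) z) +
      2 * (∑ A, ∑ B, x1 A * x1 B * D (fr e e0 A) (D (fr e e0 B) F) z) +
      4 * v z * (∑ A, x1 A * D (fr e e0 A) (D e0 (D d F)) z) +
      v z ^ 2 * D e0 (D e0 (D d (D d F))) z := by
    simp only [add_mul, mul_add, mul_assoc, Finset.sum_add_distrib, ← Finset.mul_sum]
    simp only [← mul_assoc, Finset.mul_sum]
    simp only [mul_assoc, ← Finset.mul_sum]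
    have k1 := K F hF x2
    have k2 := K' F hF x2
    have k3 := K _ hG1 x1
    have k4 := K' _ hG1 x1
    have k5 := K0 _ hG2
    simp only [mul_assoc, ← Finset.mul_sum] at k1 k2 k3 k4 k5
    rw [k1, k2, k3, k4, k5]; ring
  obtain ⟨-, eV1, eV2⟩ := eV
  obtain ⟨eE0, eE1, eE2⟩ := eE
  have hvne := hvz.ne'
  change _ = 0 + ∑ A, (x1 A * x0 A + x0 A * x1 A) at eV1
  change _ = 0 + ∑ A, (x2 A * x0 A + 2 * x1 A * x1 A + x0 A * x2 A) at eV2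
  have r1 : D d v z = D e0 (D d F) z := by
    have : ∑ A, (x1 A * x0 A + x0 A * x1 A) = 2 * ∑ A, x0 A * x1 A := by
      rw [Finset.mul_sum]; exact Finset.sum_congr rfl fun A _ => by ring
    rw [this, c01] at eV1
    have : v z * (2 * D d v z) = v z * (2 * D e0 (D d F) z) := by linarith
    have := mul_left_cancel₀ hvne this
    linarith
  have r2' : ∑ A, (x2 A * x0 A + 2 * x1 A * x1 A + x0 A * x2 A) =
      2 * (∑ A, x0 A * x2 A) + 2 * ∑ A, x1 A ^ 2 := by
    rw [Finset.mul_sum, Finset.mul_sum, ← Finset.sum_add_distrib]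
    exact Finset.sum_congr rfl fun A _ => by ring
  have r2'' : ∑ A, x1 A ^ 2 = (D e0 (D d F) z) ^ 2 + ∑ b, (D (e b) (D d F) z) ^ 2 := by
    rw [Fintype.sum_option]; rfl
  rw [r2', c02, r2''] at eV2
  have r2 : v z * D d (D d v) z + (D d v z) ^ 2 =
      ∑ b, (D (e b) (D d F) z) ^ 2 + (D e0 (D d F) z) ^ 2 + v z * D e0 (D d (D d F)) z := by
    linarith
  change _ = _ - ∑ A, ∑ B, x0 A * x0 B * D (fr e e0 A) (D (fr e e0 B) F) z at eE0
  change _ = _ - ∑ A, ∑ B, ((x1 A * x0 B + x0 A * x1 B) * D (fr e e0 A) (D (fr e e0 B) F) z +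
        x0 A * x0 B * D (fr e e0 A) (D (fr e e0 B) (D d F)) z) at eE1
  change _ = _ - ∑ A, ∑ B, ((x2 A * x0 B + 2 * x1 A * x1 B + x0 A * x2 B) *
          D (fr e e0 A) (D (fr e e0 B) F) z +
        2 * (x1 A * x0 B + x0 A * x1 B) * D (fr e e0 A) (D (fr e e0 B) (D d F)) z +
        x0 A * x0 B * D (fr e e0 A) (D (fr e e0 B) (D d (D d F))) z) at eE2
  rw [K0 F hF] at eE0
  rw [N1] at eE1
  rw [N2] at eE2
  have sq1 : ∑ A, ∑ B, x1 A * x1 B * D (fr e e0 A) (D (fr e e0 B) F) z =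
      ∑ b, ∑ c, D (e b) (D d F) z * D (e c) (D d F) z * D (e b) (D (e c) F) z
          + 2 * D e0 (D d F) z * (∑ b, D (e b) (D d F) z * D (e b) (D e0 F) z)
          + (D e0 (D d F) z) ^ 2 * D e0 (D e0 F) z := by
    simp only [Fintype.sum_option, Finset.sum_add_distrib]
    have t1 : ∑ b, x1 none * x1 (some b) * D (fr e e0 none) (D (fr e e0 (some b)) F) z =
        D e0 (D d F) z * ∑ b, D (e b) (D d F) z * D (e b) (D e0 F) z := by
      rw [Finset.mul_sum]
      refine Finset.sum_congr rfl fun b _ => ?_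
      simp only [hx1, fr_none, fr_some]
      rw [D_comm hW hF e0 (e b) hz]; ring
    have t2 : ∑ b, x1 (some b) * x1 none * D (fr e e0 (some b)) (D (fr e e0 none) F) z =
        D e0 (D d F) z * ∑ b, D (e b) (D d F) z * D (e b) (D e0 F) z := by
      rw [Finset.mul_sum]
      refine Finset.sum_congr rfl fun b _ => ?_
      simp only [hx1, fr_none, fr_some]
      ring
    rw [t1, t2]
    simp only [hx1, fr_none, fr_some]
    ring
  rw [sq1] at eE2
  simp only [Fintype.sum_option, hx1, hx2, fr_none, fr_some] at eE0 eE1 eE2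
  generalize (∑ b, ∑ c, D (e b) (D d F) z * D (e c) (D d F) z * D (e b) (D (e c) F) z) = q1 at *
  generalize (∑ b, D (e b) (D d F) z * D (e b) (D e0 F) z) = q2 at *
  generalize (∑ b, D (e b) (D d F) z * D (e b) (D e0 (D d F)) z) = q3 at *
  generalize (∑ b, D (e b) (D d (D d F)) z * D (e b) (D e0 F) z) = q4 at *
  generalize (∑ a, D (e a) (D (e a) (D d (D d F))) z) = q5 at *
  generalize (∑ a, D (e a) (D (e a) (D d F)) z) = q6 at *
  generalize (∑ a, D (e a) (D (e a) F) z) = q7 at *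
  generalize (∑ b, (D (e b) (D d F) z) ^ 2) = q8 at *
  have r3 : v z * H z = q7 := by
    have : v z ^ 2 * (v z * H z) = v z ^ 2 * q7 := by linarith
    exact mul_left_cancel₀ (pow_ne_zero 2 hvne) this
  have r4 : D d v z * H z + v z * D d H z = q6 - 2 / v z * q2 := by
    have : v z ^ 2 * (D d v z * H z + v z * D d H z) = v z ^ 2 * (q6 - 2 / v z * q2) := by
      have : v z ^ 2 * (q6 - 2 / v z * q2) = v z ^ 2 * q6 - 2 * v z * q2 := by field_simp
      rw [this, r1]
      rw [r1, r3] at eE1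
      linear_combination eE1
    exact mul_left_cancel₀ (pow_ne_zero 2 hvne) this
  refine ⟨r1, r2, r3, r4, ?_⟩
  have r4' : v z * (q6 - (D d v z * H z + v z * D d H z)) = 2 * q2 := by
    rw [r4]; field_simp; ring
  rw [r1] at r4' eE2 ⊢
  rw [r1] at r2
  rw [r3] at eE2
  linear_combination eE2 + 2 * D e0 (D e0 F) z * r2 + 4 * D e0 (D d F) z * r4'
end Ejets
end LCB
end part2

section part3
namespace LCB

theorem core_algebra {n : ℕ} (i : Fin n) (v H f κ α θ c ψ lam h00 X0 H2 vt ft Ht : ℝ)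
    (L σ v1 v2 f1 f2 H1 X Y μ A1 A2 B2 : Fin n → ℝ) (T : Fin n → Fin n → ℝ)
    (hv : 0 < v) (hH : 0 < H) (hκ : 0 < κ) (hlam : 0 < lam) (hα : 0 < α) (hfp : 0 < f)
    (hfc : 0 < f - c) (hψ : 0 < ψ)
    (hμ : ∀ b, μ b = if b = i then lam else 0) (hLi : L i = lam)
    (hσ : ∑ b, σ b ^ 2 = 1 - 1 / v ^ 2)
    (ha : ∀ b, v1 b = v ^ 2 * σ b * L b)
    (hb : ∀ b, v2 b = v * L b ^ 2 + v * ∑ c, σ c * T b c)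
    (hc : H = ∑ b, L b)
    (hd : ∀ b, v1 b * H + v * H1 b = ∑ a, T a b - 2 * L b * v1 b)
    (he : vt * H + v * Ht = ∑ a, (v2 a * f + 2 * v1 a * f1 a + v * f2 a)
      - 2 / v * ∑ b, (v1 b * f + v * f1 b) * v1 b)
    (hf : vt = v * ∑ b, σ b * (v1 b * f + v * f1 b))
    (hX : ∀ b, X b = T i b) (hX0 : X0 = v * ∑ b, σ b * X b)
    (hg : (v2 i * H + 2 * v1 i * H1 i + v * H2) * v ^ 2 = v ^ 2 * ∑ a, Y a
      - 2 * v * ∑ b, X b * v1 b + 2 * h00 * ((v * lam) ^ 2 + v1 i ^ 2)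
      + 8 * v1 i * (v * lam * v1 i)
      - 2 * ((v * lam) ^ 2 * (v * lam) + 2 * v1 i * (v * lam * v1 i) + v1 i ^ 2 * h00)
      - 4 * v * (v * lam * X0))
    (hf1 : ∀ b, f1 b = κ * H1 b)
    (hf2 : f2 i = κ * H2 + κ * (α - 1) / H * H1 i ^ 2)
    (hft : ft = κ * Ht) (hκH : κ * H = α * f)
    (hA1 : ∀ b, A1 b = X b - 2 * μ b * v1 i)
    (hA2 : ∀ b, A2 b = Y b - 4 * μ b * X0 + 2 * μ b ^ 2 * h00)
    (hB2 : ∀ b, B2 b = 2 * μ b ^ 2 + 2 * σ i * (T b i - 2 * μ b * v1 b))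
    (m1 : ∀ b, A1 b / (v * lam) - v1 b / v - θ * (f1 b / (f - c)) - σ b / ψ = 0)
    (m2 : ∀ b, A2 b / (v * lam) - (A1 b / (v * lam)) ^ 2 - (v2 b / v - (v1 b / v) ^ 2) - B2 b
      - θ * (f2 b / (f - c) - (f1 b / (f - c)) ^ 2) + (- (v * L b) / ψ - (σ b / ψ) ^ 2) ≤ 0)
    (mt : 0 ≤ (v2 i * f + 2 * v1 i * f1 i + v * f2 i) / (v * lam) - vt / v
      - 2 * σ i * (v1 i * f + v * f1 i) - θ * (ft / (f - c)) - v * f / ψ) :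
    0 ≤ κ * ∑ b, L b ^ 2 + κ * ∑ b, (θ * (f1 b / (f - c)) + σ b / ψ) ^ 2
      + (α - 1) / α * (f1 i ^ 2 / (f * lam)) + (1 - α) * f * lam
      - θ * κ * (f / (f - c)) * ∑ b, L b ^ 2 - κ * θ * ∑ b, (f1 b / (f - c)) ^ 2
      - (1 - α) * f / (v * ψ) + κ * (1 - 1 / v ^ 2) / ψ ^ 2 := by
  have hv0 := hv.ne'
  have hH0 := hH.ne'
  have hl0 := hlam.ne'
  have hκ0 := hκ.ne'
  have hα0 := hα.ne'
  have hf0 := hfp.ne'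
  have hfc0 := hfc.ne'
  have hψ0 := hψ.ne'
  set gq : Fin n → ℝ := fun b => θ * (f1 b / (f - c)) + σ b / ψ with hgq
  have A1e : ∀ b, A1 b = lam * v1 b + v * lam * gq b := by
    intro b
    have := m1 b
    have h2 : A1 b / (v * lam) = v1 b / v + gq b := by simp only [hgq]; linarith
    rw [div_eq_iff (by positivity)] at h2
    rw [h2]; field_simp
  have Xe : ∀ b, X b = lam * v1 b + v * lam * gq b + 2 * μ b * v1 i := by
    intro b; have := hA1 b; rw [A1e b] at this; linarith
  have summu : ∀ w : Fin n → ℝ, ∑ b, μ b * w b = lam * w i := by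
    intro w; simp [hμ]
  -- ΣX v1
  have q1 : ∑ b, X b * v1 b = lam * ∑ b, v1 b ^ 2 + v * lam * ∑ b, v1 b * gq b
      + 2 * lam * v1 i ^ 2 := by
    have : ∀ b, X b * v1 b = lam * v1 b ^ 2 + v * lam * (v1 b * gq b) +
        μ b * (2 * v1 i * v1 b) := by intro b; rw [Xe b]; ring
    simp only [this, Finset.sum_add_distrib, ← Finset.mul_sum, summu]; ring
  have q2 : ∑ b, σ b * X b = lam * ∑ b, σ b * v1 b + v * lam * ∑ b, σ b * gq b
      + 2 * lam * v1 i * σ i := by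
    have : ∀ b, σ b * X b = lam * (σ b * v1 b) + v * lam * (σ b * gq b) +
        μ b * (2 * v1 i * σ b) := by intro b; rw [Xe b]; ring
    simp only [this, Finset.sum_add_distrib, ← Finset.mul_sum, summu]; ring
  have q3 : ∑ b, A2 b = ∑ b, Y b - 4 * lam * X0 + 2 * lam ^ 2 * h00 := by
    have : ∀ b, A2 b = Y b + μ b * (-4 * X0 + 2 * h00 * μ b) := by intro b; rw [hA2 b]; ring
    simp only [this, Finset.sum_add_distrib, summu]
    rw [hμ i]; simp; ring
  have q4 : ∑ b, B2 b = 2 * lam ^ 2 + 2 * σ i * (v1 i * H + v * H1 i) := by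
    have : ∀ b, B2 b = μ b * (2 * μ b - 4 * σ i * v1 b) + 2 * σ i * T b i := by
      intro b; rw [hB2 b]; ring
    simp only [this, Finset.sum_add_distrib, summu, ← Finset.mul_sum]
    rw [hμ i, hd i, hLi]; simp; ring
  -- S2
  have S2 : v2 i * H + 2 * v1 i * H1 i + v * H2 = ∑ b, A2 b
      - 2 / v * (lam * ∑ b, v1 b ^ 2 + v * lam * ∑ b, v1 b * gq b) - 2 * v * lam ^ 3 := by
    have : (v2 i * H + 2 * v1 i * H1 i + v * H2) * v ^ 2 = (∑ b, A2 b
      - 2 / v * (lam * ∑ b, v1 b ^ 2 + v * lam * ∑ b, v1 b * gq b) - 2 * v * lam ^ 3) * v ^ 2 := by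
      rw [hg, q3, q1]; field_simp; ring
    exact mul_right_cancel₀ (pow_ne_zero 2 hv0) this
  have S3 : v2 i * f + 2 * v1 i * f1 i + v * f2 i = κ * (∑ b, A2 b
      - 2 / v * (lam * ∑ b, v1 b ^ 2 + v * lam * ∑ b, v1 b * gq b) - 2 * v * lam ^ 3)
      + (1 - α) * f * v2 i + v * (κ * (α - 1) / H * H1 i ^ 2) := by
    rw [← S2, hf1 i, hf2]
    linear_combination (-v2 i) * hκH
  have S4 : v2 i = v * lam ^ 2 + v * (lam * ∑ b, σ b * v1 b + v * lam * ∑ b, σ b * gq b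
      + 2 * lam * v1 i * σ i) := by
    rw [hb i, hLi, ← q2]; simp only [hX]
  have v1i : v1 i = v ^ 2 * σ i * lam := by rw [ha i, hLi]
  -- Σ v2
  have sv2 : ∑ b, v2 b = v * ∑ b, L b ^ 2 + v * (H * ∑ b, σ b * v1 b + v * ∑ b, σ b * H1 b)
      + 2 / v * ∑ b, v1 b ^ 2 := by
    have e1 : ∑ b, ∑ c, σ c * T b c = ∑ c, σ c * (v1 c * H + v * H1 c + 2 * L c * v1 c) := by
      rw [Finset.sum_comm]
      refine Finset.sum_congr rfl fun c _ => ?_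
      rw [← Finset.mul_sum, hd c]; ring
    have e2 : ∀ c, σ c * (v1 c * H + v * H1 c + 2 * L c * v1 c) =
        H * (σ c * v1 c) + v * (σ c * H1 c) + 2 / v ^ 2 * v1 c ^ 2 := by
      intro c
      have := ha c
      have h3 : σ c * L c = v1 c / v ^ 2 := by rw [this]; field_simp
      have : σ c * (v1 c * H + v * H1 c + 2 * L c * v1 c) =
        H * (σ c * v1 c) + v * (σ c * H1 c) + 2 * (σ c * L c) * v1 c := by ring
      rw [this, h3]; ring
    simp only [hb, Finset.sum_add_distrib, ← Finset.mul_sum, e1, e2]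
    field_simp
    ring
  have sσf : ∑ b, σ b * f1 b = κ * ∑ b, σ b * H1 b := by
    rw [Finset.mul_sum]; exact Finset.sum_congr rfl fun b _ => by rw [hf1 b]; ring
  have vte : vt = v * f * ∑ b, σ b * v1 b + v ^ 2 * ∑ b, σ b * f1 b := by
    rw [hf]
    have : ∀ b, σ b * (v1 b * f + v * f1 b) = f * (σ b * v1 b) + v * (σ b * f1 b) := by
      intro b; ring
    simp only [this, Finset.sum_add_distrib, ← Finset.mul_sum]; ring
  have S5 : vt - κ * ∑ b, v2 b = (1 - α) * f * v * ∑ b, σ b * v1 b - κ * v * ∑ b, L b ^ 2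
      - 2 * κ / v * ∑ b, v1 b ^ 2 := by
    rw [vte, sv2, sσf]
    linear_combination (- v * ∑ b, σ b * v1 b) * hκH
  have hHt : v * Ht = f * ∑ b, v2 b + v * ∑ b, f2 b - 2 * f / v * ∑ b, v1 b ^ 2 - vt * H := by
    have e1 : ∑ b, (v1 b * f + v * f1 b) * v1 b = f * ∑ b, v1 b ^ 2 + v * ∑ b, v1 b * f1 b := by
      have : ∀ b, (v1 b * f + v * f1 b) * v1 b = f * v1 b ^ 2 + v * (v1 b * f1 b) := by
        intro b; ring
      simp only [this, Finset.sum_add_distrib, ← Finset.mul_sum]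
    have e2 : ∑ a, (v2 a * f + 2 * v1 a * f1 a + v * f2 a) =
        f * ∑ b, v2 b + 2 * ∑ b, v1 b * f1 b + v * ∑ b, f2 b := by
      have : ∀ a, v2 a * f + 2 * v1 a * f1 a + v * f2 a =
        f * v2 a + 2 * (v1 a * f1 a) + v * f2 a := by intro b; ring
      simp only [this, Finset.sum_add_distrib, ← Finset.mul_sum]
    rw [e1, e2] at he
    have : 2 / v * (f * ∑ b, v1 b ^ 2 + v * ∑ b, v1 b * f1 b) =
      2 * f / v * ∑ b, v1 b ^ 2 + 2 * ∑ b, v1 b * f1 b := by field_simp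
    rw [this] at he
    linarith
  have S6 : ft - κ * ∑ b, f2 b = κ * f * ∑ b, L b ^ 2 + (1 - α) * f * v * ∑ b, σ b * f1 b := by
    have : v * (ft - κ * ∑ b, f2 b) =
        v * (κ * f * ∑ b, L b ^ 2 + (1 - α) * f * v * ∑ b, σ b * f1 b) := by
      rw [hft]
      have : v * (κ * Ht - κ * ∑ b, f2 b) = κ * (v * Ht) - κ * v * ∑ b, f2 b := by ring
      rw [this, hHt, sv2, vte, sσf]
      linear_combination (- (v ^ 2) * κ * ∑ b, σ b * H1 b) * hκH
    exact mul_left_cancel₀ hv0 this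
  -- sum of m2
  have M2 : (∑ b, A2 b) / (v * lam) - (1 / v ^ 2 * ∑ b, v1 b ^ 2 + 2 / v * ∑ b, v1 b * gq b
      + ∑ b, gq b ^ 2) - (∑ b, v2 b) / v + 1 / v ^ 2 * ∑ b, v1 b ^ 2 - ∑ b, B2 b
      - θ * ((∑ b, f2 b) / (f - c)) + θ * ∑ b, (f1 b / (f - c)) ^ 2 - v * H / ψ
      - (1 - 1 / v ^ 2) / ψ ^ 2 ≤ 0 := by
    have h := Finset.sum_nonpos (s := Finset.univ) (fun b _ => m2 b)
    refine le_of_eq_of_le ?_ h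
    rw [← hσ, hc]
    simp only [Finset.sum_div, Finset.mul_sum, ← Finset.sum_sub_distrib, ← Finset.sum_add_distrib]
    refine Finset.sum_congr rfl fun b _ => ?_
    rw [A1e b]
    field_simp
    ring
  have sgq : ∑ b, σ b * gq b = θ / (f - c) * ∑ b, σ b * f1 b + (1 - 1 / v ^ 2) / ψ := by
    have : ∀ b, σ b * gq b = θ / (f - c) * (σ b * f1 b) + 1 / ψ * σ b ^ 2 := by
      intro b; simp only [hgq]; field_simp
    simp only [this, Finset.sum_add_distrib, ← Finset.mul_sum, hσ]; ring
  have bad : v * (κ * (α - 1) / H * H1 i ^ 2) / (v * lam) =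
      (α - 1) / α * (f1 i ^ 2 / (f * lam)) := by
    rw [hf1 i]
    have : f = κ * H / α := by rw [hκH]; field_simp
    rw [this]; field_simp
  -- final combination
  have M2' := mul_nonpos_of_nonneg_of_nonpos hκ.le M2
  have fin : 0 ≤ ((v2 i * f + 2 * v1 i * f1 i + v * f2 i) / (v * lam) - vt / v
      - 2 * σ i * (v1 i * f + v * f1 i) - θ * (ft / (f - c)) - v * f / ψ) - κ * ((∑ b, A2 b) / (v * lam) - (1 / v ^ 2 * ∑ b, v1 b ^ 2 + 2 / v * ∑ b, v1 b * gq b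
      + ∑ b, gq b ^ 2) - (∑ b, v2 b) / v + 1 / v ^ 2 * ∑ b, v1 b ^ 2 - ∑ b, B2 b
      - θ * ((∑ b, f2 b) / (f - c)) + θ * ∑ b, (f1 b / (f - c)) ^ 2 - v * H / ψ
      - (1 - 1 / v ^ 2) / ψ ^ 2) := by linarith
  refine le_of_le_of_eq fin ?_
  have vt' : vt = κ * ∑ b, v2 b + ((1 - α) * f * v * ∑ b, σ b * v1 b - κ * v * ∑ b, L b ^ 2
      - 2 * κ / v * ∑ b, v1 b ^ 2) := by linarith
  have ft' : ft = κ * ∑ b, f2 b + (κ * f * ∑ b, L b ^ 2 + (1 - α) * f * v * ∑ b, σ b * f1 b) := by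
    linarith
  have u1 : (v2 i * f + 2 * v1 i * f1 i + v * f2 i) / (v * lam) =
      κ * ((∑ b, A2 b) / (v * lam)) - 2 * κ / v ^ 2 * ∑ b, v1 b ^ 2
      - 2 * κ / v * ∑ b, v1 b * gq b - 2 * κ * lam ^ 2
      + (1 - α) * f * (lam + ∑ b, σ b * v1 b + v * ∑ b, σ b * gq b + 2 * v1 i * σ i)
      + (α - 1) / α * (f1 i ^ 2 / (f * lam)) := by
    rw [← bad, S3, S4]; field_simp; ring
  have u2 : vt / v = κ * ((∑ b, v2 b) / v) + (1 - α) * f * ∑ b, σ b * v1 b - κ * ∑ b, L b ^ 2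
      - 2 * κ / v ^ 2 * ∑ b, v1 b ^ 2 := by rw [vt']; field_simp; ring
  have u3 : ft / (f - c) = κ * ((∑ b, f2 b) / (f - c)) + κ * (f / (f - c)) * ∑ b, L b ^ 2
      + (1 - α) * f * v * (1 / (f - c)) * ∑ b, σ b * f1 b := by rw [ft']; field_simp; ring
  rw [u1, u2, u3, q4, sgq, hf1 i, v1i]
  have u4 : v * H / ψ * κ = α * v * f / ψ := by rw [div_mul_eq_mul_div]; congr 1; linear_combination v * hκH
  generalize (∑ b, A2 b) / (v * lam) = z1
  generalize (∑ b, v2 b) / v = z2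
  generalize (∑ b, f2 b) / (f - c) = z3
  have u5 : (1 - α) * f * (v * ((1 - 1 / v ^ 2) / ψ)) = (1 - α) * v * f / ψ - (1 - α) * f / (v * ψ) := by
    field_simp
  linear_combination u4 + u5 + 2 * σ i * (v ^ 2 * σ i * lam) * hκH
end LCB
end part3

section part4
namespace LCB
open Filter Topology
open scoped ContDiff

theorem Jet2.eq' {f : ℝ → ℝ} {a b c a' b' c' : ℝ} (hf : Jet2 f a b c) (ha : a = a') (hb : b = b')
    (hc : c = c') : Jet2 f a' b' c' := by subst ha hb hc; exact hf

theorem Jet2.left {f : ℝ → ℝ} {a b c : ℝ} (hf : Jet2 f a b c)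
    (hm : ∀ᶠ s in 𝓝[≤] (0:ℝ), f s ≤ f 0) : 0 ≤ b := by
  have h := hf.hasDerivAt
  have h2 : HasDerivWithinAt f b (Iio 0) 0 := h.hasDerivWithinAt
  rw [hasDerivWithinAt_iff_tendsto_slope' (by simp)] at h2
  refine ge_of_tendsto h2 ?_
  have hm' : ∀ᶠ s in 𝓝[<] (0:ℝ), f s ≤ f 0 := nhdsWithin_mono _ Iio_subset_Iic_self hm
  filter_upwards [hm', self_mem_nhdsWithin] with s hs hs0
  rw [slope_def_field]
  have : s - 0 < 0 := by simpa using hs0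
  exact div_nonneg_of_nonpos (by linarith) this.le

variable {Z : Type*} [NormedAddCommGroup Z] [NormedSpace ℝ Z]

theorem local_key {n : ℕ} {W : Set Z} (hW : IsOpen W) {F v H f : Z → ℝ}
    (hF : ContDiffOn ℝ ∞ F W) (hv : ContDiffOn ℝ ∞ v W) (hH : ContDiffOn ℝ ∞ H W)
    (hf : ContDiffOn ℝ ∞ f W)
    (e : Fin n → Z) (e0 τ : Z) (α θ c a : ℝ) (hα : 0 < α)
    (hV : ∀ z ∈ W, v z ^ 2 = 1 + ∑ A, (D (fr e e0 A) F z) ^ 2)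
    (hE : ∀ z ∈ W, v z * H z * v z ^ 2 =
      v z ^ 2 * (∑ A, D (fr e e0 A) (D (fr e e0 A) F) z) -
      ∑ A, ∑ B, D (fr e e0 A) F z * D (fr e e0 B) F z * D (fr e e0 A) (D (fr e e0 B) F) z)
    (hfH : ∀ z ∈ W, f z = H z ^ α) (hflow : ∀ z ∈ W, D τ F z = v z * f z)
    {z : Z} (hz : z ∈ W) (hvz : 0 < v z) (hHz : 0 < H z) (L : Fin n → ℝ)
    (hL : ∀ a b, D (e a) (D (e b) F) z = if a = b then v z * L b else 0)
    (he0 : e0 = v z • ∑ b, D (e b) F z • e b)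
    (hσ : ∑ b, (D (e b) F z) ^ 2 = 1 - 1 / v z ^ 2)
    (i : Fin n) (lam : ℝ) (hLi : L i = lam) (hlam : 0 < lam) (hfc : 0 < f z - c) (hψ : 0 < a - F z)
    (hmax : ∀ b, ∀ μ : ℝ, μ = (if b = i then lam else 0) → IsLocalMax (fun s : ℝ =>
      Real.log (D (e i) (D (e i) F) (z + s • e b)
        - 2 * μ * s * D (e i) (D e0 F) (z + s • e b) + μ ^ 2 * s ^ 2 * D e0 (D e0 F) (z + s • e b))
      - Real.log (v (z + s • e b))
      - Real.log ((1 - D (e i) F z ^ 2) - 2 * (μ * D (e i) F z / v z) * s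
          + μ ^ 2 * (1 - 1 / v z ^ 2) * s ^ 2
          + (D (e i) F (z + s • e b) - μ * s * D e0 F (z + s • e b)) ^ 2)
      - θ * Real.log (f (z + s • e b) - c) + Real.log (a - F (z + s • e b))) 0)
    (htime : ∀ᶠ s in 𝓝[≤] (0:ℝ), Real.log (D (e i) (D (e i) F) (z + s • τ))
      - Real.log (v (z + s • τ))
      - Real.log ((1 - D (e i) F z ^ 2) + (D (e i) F (z + s • τ)) ^ 2)
      - θ * Real.log (f (z + s • τ) - c) + Real.log (a - F (z + s • τ)) ≤
      Real.log (D (e i) (D (e i) F) z) - Real.log (v z)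
      - Real.log ((1 - D (e i) F z ^ 2) + (D (e i) F z) ^ 2)
      - θ * Real.log (f z - c) + Real.log (a - F z)) :
    ∃ f1 : Fin n → ℝ, ∃ κ : ℝ, κ = α * H z ^ (α - 1) ∧
    0 ≤ κ * ∑ b, L b ^ 2 + κ * ∑ b, (θ * (f1 b / (f z - c)) + D (e b) F z / (a - F z)) ^ 2
      + (α - 1) / α * (f1 i ^ 2 / (f z * lam)) + (1 - α) * f z * lam
      - θ * κ * (f z / (f z - c)) * ∑ b, L b ^ 2 - κ * θ * ∑ b, (f1 b / (f z - c)) ^ 2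
      - (1 - α) * f z / (v z * (a - F z)) + κ * (1 - 1 / v z ^ 2) / (a - F z) ^ 2 := by
  classical
  have hfz : 0 < f z := by rw [hfH z hz]; positivity
  have hv0 := hvz.ne'
  have De0 : ∀ G : Z → ℝ, D e0 G z = v z * ∑ b, D (e b) F z * D (e b) G z := by
    intro G; rw [he0, D_smul, D_sum]
  have hP : ∑ A, D (fr e e0 A) F z • fr e e0 A = v z • e0 := by
    rw [Fintype.sum_option]
    simp only [fr_none, fr_some]
    have h1 : D e0 F z = v z - 1 / v z := by
      rw [De0]; simp only [← pow_two]; rw [hσ]; field_simp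
    have h2 : ∑ b, D (e b) F z • e b = (1 / v z) • e0 := by
      conv_rhs => rw [he0]
      rw [smul_smul]; simp [hv0]
    rw [h1, h2, ← add_smul]; congr 1; ring
  have De0F : D e0 F z = v z - 1 / v z := by
    rw [De0]; simp only [← pow_two]; rw [hσ]; field_simp
  have raw := raw_jets hW hF hv hH e e0 hV hE hz hvz hP
  set κ := α * H z ^ (α - 1) with hκdef
  set vv := v z with hvv
  set σ : Fin n → ℝ := fun b => D (e b) F z with hσdef
  set μ : Fin n → ℝ := fun b => if b = i then lam else 0 with hμ
  set T : Fin n → Fin n → ℝ := fun b c => D (e c) (D (e b) (D (e b) F)) z with hT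
  set X : Fin n → ℝ := fun b => D (e b) (D (e i) (D (e i) F)) z with hX
  set Y : Fin n → ℝ := fun b => D (e b) (D (e b) (D (e i) (D (e i) F))) z with hY
  set X0 := D e0 (D (e i) (D (e i) F)) z with hX0
  set h00 := D e0 (D e0 F) z with hh00
  set v1 : Fin n → ℝ := fun b => D (e b) v z with hv1
  set v2 : Fin n → ℝ := fun b => D (e b) (D (e b) v) z with hv2
  set f1 : Fin n → ℝ := fun b => D (e b) f z with hf1
  set f2 : Fin n → ℝ := fun b => D (e b) (D (e b) f) z with hf2
  set H1 : Fin n → ℝ := fun b => D (e b) H z with hH1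
  have De0b : ∀ b, D e0 (D (e b) F) z = v1 b := fun b => (raw (e b)).1.symm
  have Dbe0 : ∀ b, D (e b) (D e0 F) z = v1 b := fun b => by rw [D_comm hW hF _ _ hz, De0b]
  have ha : ∀ b, v1 b = vv ^ 2 * σ b * L b := by
    intro b; rw [← De0b, De0]; simp [hL, hσdef]; ring
  have hb : ∀ b, v2 b = vv * L b ^ 2 + vv * ∑ c, σ c * T b c := by
    intro b
    have := (raw (e b)).2.1
    rw [De0b, De0] at this
    have h2 : ∑ b_1, D (e b_1) (D (e b) F) z ^ 2 = (vv * L b) ^ 2 := by simp [hL]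
    rw [h2] at this
    have h3 : vv * v2 b = vv * (vv * L b ^ 2 + vv * ∑ c, σ c * T b c) := by
      simp only [hv2, hσdef, hT]
      simp only [hv1] at this
      linear_combination this
    exact mul_left_cancel₀ hv0 h3
  have hc : H z = ∑ b, L b := by
    have := (raw e0).2.2.1
    simp only [hL, if_true, ← Finset.mul_sum] at this
    exact mul_left_cancel₀ hv0 this
  have hd : ∀ b, v1 b * H z + vv * H1 b = ∑ a, T a b - 2 * L b * v1 b := by
    intro b
    have := (raw (e b)).2.2.2.1
    simp only [Dbe0, hL] at this
    rw [this]
    congr 1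
    · exact Finset.sum_congr rfl fun a _ => D21_comm hW hF _ _ hz
    · simp; field_simp
  -- jets of Dτ F
  have jτ : ∀ b, D (e b) (D τ F) z = v1 b * f z + vv * f1 b ∧
      D (e b) (D (e b) (D τ F)) z = v2 b * f z + 2 * v1 b * f1 b + vv * f2 b := by
    intro b
    have j1 := line_jet hW (D_smooth hW hF τ) hz (e b)
    have j2 := (line_jet hW hv hz (e b)).mul (line_jet hW hf hz (e b))
    have j3 := j2.congr (g := fun s => D τ F (z + s • e b)) (by
      filter_upwards [line_mem hW hz (e b)] with s hs using (hflow _ hs).symm)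
    have := j1.unique j3
    exact ⟨this.2.1, this.2.2⟩
  have he : D τ v z * H z + vv * D τ H z = ∑ a, (v2 a * f z + 2 * v1 a * f1 a + vv * f2 a)
      - 2 / vv * ∑ b, (v1 b * f z + vv * f1 b) * v1 b := by
    have := (raw τ).2.2.2.1
    rw [this]
    simp only [Dbe0, (jτ _).1, (jτ _).2]
  have hft : D τ v z = vv * ∑ b, σ b * (v1 b * f z + vv * f1 b) := by
    rw [(raw τ).1, De0]; simp only [(jτ _).1, hσdef]
  have hX0' : X0 = vv * ∑ b, σ b * X b := by rw [hX0, De0]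
  have hLii : D (e i) (D (e i) F) z = vv * lam := by rw [hL]; simp [hLi]
  have sumL : ∀ w : Fin n → ℝ, ∑ b, D (e b) (D (e i) F) z * w b = vv * lam * w i := by
    intro w; simp [hL, hLi]
  have hg : (v2 i * H z + 2 * v1 i * H1 i + vv * D (e i) (D (e i) H) z) * vv ^ 2
      = vv ^ 2 * ∑ a, Y a
      - 2 * vv * ∑ b, X b * v1 b + 2 * h00 * ((vv * lam) ^ 2 + v1 i ^ 2)
      + 8 * v1 i * (vv * lam * v1 i)
      - 2 * ((vv * lam) ^ 2 * (vv * lam) + 2 * v1 i * (vv * lam * v1 i) + v1 i ^ 2 * h00)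
      - 4 * vv * (vv * lam * X0) := by
    have := (raw (e i)).2.2.2.2
    have e1 : ∑ b, (D (e b) (D (e i) F) z) ^ 2 = (vv * lam) ^ 2 := by
      simp only [pow_two, sumL, hLii]
    have e2 : ∑ b, ∑ c, D (e b) (D (e i) F) z * D (e c) (D (e i) F) z * D (e b) (D (e c) F) z
        = (vv * lam) ^ 2 * (vv * lam) := by
      have : ∀ b, ∑ c, D (e b) (D (e i) F) z * D (e c) (D (e i) F) z * D (e b) (D (e c) F) z
        = D (e b) (D (e i) F) z * (vv * lam * D (e b) (D (e i) F) z) := by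
        intro b; rw [← sumL (fun c => D (e b) (D (e c) F) z), Finset.mul_sum]; exact Finset.sum_congr rfl fun c _ => by ring
      simp only [this, sumL, hLii]; ring
    have e3 : ∑ b, D (e b) (D (e i) F) z * D (e b) (D e0 (D (e i) F)) z = vv * lam * X0 := by
      rw [sumL, D_comm hW (D_smooth hW hF _) _ _ hz]
    rw [e1, e2, e3] at this
    simp only [Dbe0, De0b, sumL] at this
    exact this
  -- jets of f
  have jf : ∀ d, D d f z = κ * D d H z ∧ D d (D d f) z =
      κ * D d (D d H) z + κ * (α - 1) / H z * (D d H z) ^ 2 := by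
    intro d
    have j1 := line_jet hW hf hz d
    have j2 := ((line_jet hW hH hz d).rpow hHz α).congr (g := fun s => f (z + s • d)) (by
      filter_upwards [line_mem hW hz d] with s hs using (hfH _ hs).symm)
    have := j1.unique j2
    refine ⟨this.2.1, ?_⟩
    rw [this.2.2, hκdef]
    have : H z ^ (α - 1) = H z ^ (α - 2) * H z := by
      rw [← Real.rpow_add_one hHz.ne']; congr 1; ring
    rw [this]; field_simp; ring
  have hκH : κ * H z = α * f z := by
    rw [hfH z hz, hκdef, mul_assoc, ← Real.rpow_add_one hHz.ne']; congr 2; ring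
  have hκ : 0 < κ := by positivity
  -- spatial maximum
  have hT3 : ∀ b, D (e b) (D (e b) (D (e i) F)) z = T b i := fun b => D21_comm hW hF _ _ hz
  have hbi : ∀ b, D (e b) (D (e i) F) z = vv * μ b := by
    intro b; rw [hL]; simp only [hμ]; split_ifs with h <;> simp [hLi]
  have hm : ∀ b, (X b - 2 * μ b * v1 i) / (vv * lam) - v1 b / vv - θ * (f1 b / (f z - c))
        - σ b / (a - F z) = 0 ∧
      (Y b - 4 * μ b * X0 + 2 * μ b ^ 2 * h00) / (vv * lam)
      - ((X b - 2 * μ b * v1 i) / (vv * lam)) ^ 2 - (v2 b / vv - (v1 b / vv) ^ 2)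
      - (2 * μ b ^ 2 + 2 * σ i * (T b i - 2 * μ b * v1 b))
      - θ * (f2 b / (f z - c) - (f1 b / (f z - c)) ^ 2)
      + (- (vv * L b) / (a - F z) - (σ b / (a - F z)) ^ 2) ≤ 0 := by
    intro b
    have hmx := hmax b (μ b) rfl
    have jid := Jet2.ident
    have jA := ((line_jet hW (D_smooth hW (D_smooth hW hF (e i)) (e i)) hz (e b)).sub
      (((Jet2.const (2 * μ b)).mul jid).mul
        (line_jet hW (D_smooth hW (D_smooth hW hF e0) (e i)) hz (e b)))).add
      (((Jet2.const (μ b ^ 2)).mul (jid.mul jid)).mul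
        (line_jet hW (D_smooth hW (D_smooth hW hF e0) e0) hz (e b)))
    have hXD : μ b * D (e b) (D (e i) (D e0 F)) z = μ b * X0 := by
      by_cases h : b = i
      · subst h
        congr 1
        rw [D_congr hW (fun y hy => D_comm hW hF (e b) e0 hy) (e b) hz,
          D_comm hW (D_smooth hW hF _) _ _ hz]
      · simp [hμ, h]
    have jA' := (jA.eq' (a' := vv * lam) (b' := X b - 2 * μ b * v1 i)
      (c' := Y b - 4 * μ b * X0 + 2 * μ b ^ 2 * h00)
      (by rw [hLii]; ring) (by rw [Dbe0]; ring) (by linear_combination (-4) * hXD)).log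
      (by positivity)
    have jv := (line_jet hW hv hz (e b)).log hvz
    have jl := (line_jet hW (D_smooth hW hF (e i)) hz (e b)).sub
      (((Jet2.const (μ b)).mul jid).mul (line_jet hW (D_smooth hW hF e0) hz (e b)))
    have jl' := jl.eq' (a' := σ i) (b' := μ b / vv) (c' := T b i - 2 * μ b * v1 b)
      (by ring) (by rw [hbi, De0F]; field_simp; ring) (by rw [hT3, Dbe0]; ring)
    have jB := ((((Jet2.const (1 - σ i ^ 2)).sub ((Jet2.const (2 * (μ b * σ i / vv))).mul jid)).add
      ((Jet2.const (μ b ^ 2 * (1 - 1 / vv ^ 2))).mul (jid.mul jid))).add (jl'.mul jl'))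
    have jB' := (jB.eq' (a' := 1) (b' := 0)
      (c' := 2 * μ b ^ 2 + 2 * σ i * (T b i - 2 * μ b * v1 b))
      (by ring) (by ring) (by field_simp; ring)).log one_pos
    have jff := (Jet2.const θ).mul (((line_jet hW hf hz (e b)).sub (Jet2.const c)).log
      (by simpa using hfc))
    have jψ := ((Jet2.const a).sub (line_jet hW hF hz (e b))).log hψ
    have jall := (((jA'.sub jv).sub jB').sub jff).add jψ
    have hmx2 : IsLocalMax _ (0:ℝ) := hmx
    have hres := (jall.congr (EventuallyEq.of_eq (by
      funext s; simp only [hσdef, ← hvv]; ring_nf))).max hmx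
    obtain ⟨r1, r2⟩ := hres
    have hLb : D (e b) (D (e b) F) z = vv * L b := by rw [hL]; simp
    rw [hLb] at r2
    constructor
    · refine Eq.trans ?_ r1
      simp only [hσdef, hf1, hv1]; ring
    · refine le_of_eq_of_le ?_ r2
      simp only [hσdef, hf1, hf2, hv1, hv2]; ring
  have hmt : 0 ≤ (v2 i * f z + 2 * v1 i * f1 i + vv * f2 i) / (vv * lam) - D τ v z / vv
      - 2 * σ i * (v1 i * f z + vv * f1 i) - θ * (D τ f z / (f z - c)) - vv * f z / (a - F z) := by
    have jA := (line_jet hW (D_smooth hW (D_smooth hW hF (e i)) (e i)) hz τ)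
    rw [D3_comm hW hF τ _ _ hz, (jτ i).2, hLii] at jA
    have jA' := jA.log (by positivity)
    have jv := (line_jet hW hv hz τ).log hvz
    have jl := line_jet hW (D_smooth hW hF (e i)) hz τ
    rw [D_comm hW hF τ _ hz, (jτ i).1] at jl
    have jB := ((Jet2.const (1 - σ i ^ 2)).add (jl.mul jl))
    have jB' := (jB.eq' (a' := 1) (b' := 2 * σ i * (v1 i * f z + vv * f1 i)) (by
      simp only [hσdef]; ring) (by simp only [hσdef]; ring) rfl).log one_pos
    have jff := (Jet2.const θ).mul (((line_jet hW hf hz τ).sub (Jet2.const c)).log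
      (by simpa using hfc))
    have jψ := ((Jet2.const a).sub (line_jet hW hF hz τ)).log hψ
    have jall := (((jA'.sub jv).sub jB').sub jff).add jψ
    have h0 := jall.left (by
      filter_upwards [htime] with s hs
      simp only [zero_smul, add_zero]
      simpa only [hσdef, pow_two] using hs)
    rw [hflow z hz] at h0
    refine le_of_le_of_eq h0 ?_
    ring
  refine ⟨f1, κ, rfl, ?_⟩
  exact core_algebra i vv (H z) (f z) κ α θ c (a - F z) lam h00 X0 (D (e i) (D (e i) H) z)
    (D τ v z) (D τ f z) (D τ H z) L σ v1 v2 f1 f2 H1 X Y μ _ _ _ T hvz hHz hκ hlam hα hfz hfc hψ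
    (fun b => rfl) hLi hσ ha hb hc hd he hft (fun b => rfl) hX0' hg (fun b => (jf _).1) (jf _).2
    (jf _).1 hκH (fun b => rfl) (fun b => rfl) (fun b => rfl) (fun b => (hm b).1)
    (fun b => (hm b).2) hmt
end LCB
end part4

section part5
namespace LCB

set_option maxHeartbeats 1000000 in
theorem const_bound (α a c : ℝ) (hα : 0 < α) (ha : 0 < a) (hc : 0 < c) (hc1 : c ≤ 1) :
    ∃ C : ℝ, 0 < C ∧ ∀ (n : ℕ) (i : Fin n) (H f κ v ψ lam : ℝ) (L σ f1 : Fin n → ℝ) (θ : ℝ),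
      θ = 1 - c ^ 2 / 8 → 0 < H → f = H ^ α → κ = α * H ^ (α - 1) → 1 ≤ v → 0 < ψ → ψ ≤ a →
      L i = lam → 0 < lam → 2 * c ≤ f → f ≤ 2 / c → ∑ b, σ b ^ 2 = 1 - 1 / v ^ 2 →
      0 ≤ κ * ∑ b, L b ^ 2 + κ * ∑ b, (θ * (f1 b / (f - c)) + σ b / ψ) ^ 2
      + (α - 1) / α * (f1 i ^ 2 / (f * lam)) + (1 - α) * f * lam
      - θ * κ * (f / (f - c)) * ∑ b, L b ^ 2 - κ * θ * ∑ b, (f1 b / (f - c)) ^ 2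
      - (1 - α) * f / (v * ψ) + κ * (1 - 1 / v ^ 2) / ψ ^ 2 → lam * ψ ≤ C := by
  set δ := c ^ 2 / 8 with hδ
  have hδ0 : 0 < δ := by positivity
  have hδ1 : δ ≤ 1 / 8 := by rw [hδ]; nlinarith
  set Hm := (2 / c) ^ (1 / α) with hHm
  have hHm0 : 0 < Hm := by positivity
  set Λ := |α - 1| * Hm / (α ^ 2 * ((1 - δ) * δ ^ 2)) with hΛ
  have hθ0 : 0 < 1 - δ := by linarith
  have hΛ0 : 0 ≤ Λ := by positivity
  set K := |α - 1| * Hm * a / α with hK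
  have hK0 : 0 ≤ K := by positivity
  refine ⟨1 + a * Λ + 4 / c ^ 2 * (2 + 1 / δ + 2 * K), by positivity, ?_⟩
  intro n i H f κ v ψ lam L σ f1 θ hθ hH hf hκ hv hψ hψa hLi hlam hf1 hf2 hσ hmain
  have hfp : 0 < f := by linarith
  have hfc : 0 < f - c := by linarith
  have hκ0 : 0 < κ := by rw [hκ]; positivity
  have hκH : κ * H = α * f := by
    rw [hf, hκ, mul_assoc, ← Real.rpow_add_one hH.ne']; congr 2; ring
  have hHle : H ≤ Hm := by
    have : H = f ^ (1 / α) := by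
      rw [hf, ← Real.rpow_mul hH.le]; field_simp; simp
    rw [this, hHm]
    exact Real.rpow_le_rpow hfp.le hf2 (by positivity)
  have hθp : 0 < θ := by rw [hθ]; exact hθ0
  by_cases hl : lam < Λ
  · have h1 : lam * ψ ≤ Λ * a := mul_le_mul hl.le hψa hψ.le hΛ0
    have h2 : 0 ≤ 4 / c ^ 2 * (2 + 1 / δ + 2 * K) := by positivity
    linarith
  push Not at hl
  set S := ∑ b, L b ^ 2 with hS
  set Gq := ∑ b, (f1 b / (f - c)) ^ 2 with hGq
  have hSl : lam ^ 2 ≤ S := by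
    rw [← hLi]; exact Finset.single_le_sum (f := fun b => L b ^ 2) (fun b _ => sq_nonneg _) (Finset.mem_univ i)
  have hGl : (f1 i / (f - c)) ^ 2 ≤ Gq :=
    Finset.single_le_sum (f := fun b => (f1 b / (f - c)) ^ 2) (fun b _ => sq_nonneg _) (Finset.mem_univ i)
  -- 1
  have t1 : 1 + c ^ 2 / 4 ≤ θ * (f / (f - c)) := by
    have h1 : 1 + c ^ 2 / 2 ≤ f / (f - c) := by
      rw [le_div_iff₀ hfc]
      have : f * c ≤ 2 := by rwa [le_div_iff₀ hc] at hf2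
      nlinarith [pow_pos hc 3]
    have h2 : θ * (1 + c ^ 2 / 2) ≤ θ * (f / (f - c)) := mul_le_mul_of_nonneg_left h1 hθp.le
    refine le_trans ?_ h2
    rw [hθ]
    have h3 : c ^ 2 ≤ 1 := pow_le_one₀ hc.le hc1
    have h4 : 0 ≤ c ^ 2 * (1 - c ^ 2) := mul_nonneg (sq_nonneg c) (by linarith)
    have h5 : 0 ≤ c ^ 2 := sq_nonneg c
    rw [hδ]
    linarith
  have T1 : κ * S - θ * κ * (f / (f - c)) * S ≤ - (κ * (c ^ 2 / 4) * lam ^ 2) := by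
    have hS0 : 0 ≤ S := le_trans (sq_nonneg _) hSl
    have h1 : κ * S * (1 + c ^ 2 / 4) ≤ κ * S * (θ * (f / (f - c))) :=
      mul_le_mul_of_nonneg_left t1 (by positivity)
    have h2 : κ * (c ^ 2 / 4) * lam ^ 2 ≤ κ * (c ^ 2 / 4) * S :=
      mul_le_mul_of_nonneg_left hSl (by positivity)
    linarith
  -- 2
  have hσ1 : ∑ b, σ b ^ 2 ≤ 1 := by rw [hσ]; have : 0 ≤ 1 / v ^ 2 := by positivity
                                    linarith
  have T2 : ∑ b, (θ * (f1 b / (f - c)) + σ b / ψ) ^ 2 ≤ (1 + δ) * θ ^ 2 * Gq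
      + (1 + 1 / δ) * (1 / ψ ^ 2) := by
    have h1 : ∑ b, (θ * (f1 b / (f - c)) + σ b / ψ) ^ 2 ≤
        ∑ b, ((1 + δ) * θ ^ 2 * (f1 b / (f - c)) ^ 2 + (1 + 1 / δ) * (1 / ψ ^ 2) * σ b ^ 2) := by
      refine Finset.sum_le_sum fun b _ => ?_
      set x := θ * (f1 b / (f - c))
      have e1 : (1 + δ) * θ ^ 2 * (f1 b / (f - c)) ^ 2 = (1 + δ) * x ^ 2 := by ring
      have e2 : (1 + 1 / δ) * (1 / ψ ^ 2) * σ b ^ 2 = (1 + 1 / δ) * (σ b / ψ) ^ 2 := by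
        rw [div_pow]; ring
      rw [e1, e2]
      set y := σ b / ψ
      have : (1 + δ) * x ^ 2 + (1 + 1 / δ) * y ^ 2 - (x + y) ^ 2 = (δ * x - y) ^ 2 / δ := by
        field_simp; ring
      have h3 : 0 ≤ (δ * x - y) ^ 2 / δ := by positivity
      linarith
    refine h1.trans ?_
    rw [Finset.sum_add_distrib, ← Finset.mul_sum, ← Finset.mul_sum]
    have : (1 + 1 / δ) * (1 / ψ ^ 2) * ∑ b, σ b ^ 2 ≤ (1 + 1 / δ) * (1 / ψ ^ 2) * 1 :=
      mul_le_mul_of_nonneg_left hσ1 (by positivity)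
    linarith
  have hthe : (1 + δ) * θ ^ 2 = θ - θ * δ ^ 2 := by rw [hθ]; ring
  rw [hthe] at T2
  have T2' := mul_le_mul_of_nonneg_left T2 hκ0.le
  -- 3
  have T3 : (α - 1) / α * (f1 i ^ 2 / (f * lam)) ≤ κ * (θ * δ ^ 2) * Gq := by
    have e1 : f1 i ^ 2 = (f1 i / (f - c)) ^ 2 * (f - c) ^ 2 := by field_simp
    have e2 : (f - c) ^ 2 ≤ f ^ 2 := by nlinarith
    have h1 : (α - 1) / α * (f1 i ^ 2 / (f * lam)) ≤ |α - 1| / α * (f1 i ^ 2 / (f * lam)) := by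
      gcongr; exact le_abs_self _
    have h2 : f1 i ^ 2 ≤ Gq * f ^ 2 := by
      rw [e1]; exact mul_le_mul hGl e2 (by positivity) (le_trans (sq_nonneg _) hGl)
    have h3 : f1 i ^ 2 / (f * lam) ≤ Gq * f / lam := by
      rw [div_le_div_iff₀ (by positivity) hlam]
      nlinarith
    have h4 : |α - 1| * f ≤ α * κ * (θ * δ ^ 2) * lam := by
      have h5 : |α - 1| * Hm ≤ lam * (α ^ 2 * (θ * δ ^ 2)) := by
        rw [hΛ, div_le_iff₀ (by positivity)] at hl; rw [hθ]; exact hl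
      have h6 : |α - 1| * H ≤ lam * (α ^ 2 * (θ * δ ^ 2)) :=
        le_trans (mul_le_mul_of_nonneg_left hHle (abs_nonneg _)) h5
      have h7 := mul_le_mul_of_nonneg_left h6 hκ0.le
      have h8 : α * (|α - 1| * f) ≤ α * (α * κ * (θ * δ ^ 2) * lam) := by
        calc α * (|α - 1| * f) = κ * (|α - 1| * H) := by linear_combination (-|α - 1|) * hκH
          _ ≤ _ := h7
          _ = _ := by ring
      exact le_of_mul_le_mul_left h8 hα
    have hG0 : 0 ≤ Gq := le_trans (sq_nonneg _) hGl
    calc (α - 1) / α * (f1 i ^ 2 / (f * lam)) ≤ |α - 1| / α * (Gq * f / lam) :=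
          h1.trans (mul_le_mul_of_nonneg_left h3 (by positivity))
      _ = Gq * (|α - 1| * f) / (α * lam) := by field_simp
      _ ≤ Gq * (α * κ * (θ * δ ^ 2) * lam) / (α * lam) := by gcongr
      _ = _ := by field_simp
  -- 4
  have T4 : (1 - α) * f * lam ≤ |α - 1| * f * lam := by
    gcongr; rw [abs_sub_comm]; exact le_abs_self _
  have T5 : - ((1 - α) * f / (v * ψ)) ≤ |α - 1| * f / ψ := by
    have h1 : - ((1 - α) * f / (v * ψ)) = (α - 1) * (f / (v * ψ)) := by ring
    rw [h1]
    have h2 : f / (v * ψ) ≤ f / ψ := by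
      apply div_le_div_of_nonneg_left hfp.le hψ; nlinarith
    calc (α - 1) * (f / (v * ψ)) ≤ |α - 1| * (f / (v * ψ)) := by gcongr; exact le_abs_self _
      _ ≤ |α - 1| * (f / ψ) := by gcongr
      _ = _ := by ring
  have T6 : κ * (1 - 1 / v ^ 2) / ψ ^ 2 ≤ κ * (1 / ψ ^ 2) := by
    have : 0 ≤ 1 / v ^ 2 := by positivity
    have : κ * (1 - 1 / v ^ 2) ≤ κ * 1 := by gcongr; linarith
    calc _ ≤ κ * 1 / ψ ^ 2 := by gcongr
      _ = _ := by ring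
  have T7 : κ * (c ^ 2 / 4) * lam ^ 2 ≤ κ * (1 / ψ ^ 2) * (2 + 1 / δ) + |α - 1| * f * lam
      + |α - 1| * f / ψ := by linarith
  have T8 : c ^ 2 / 4 * (lam * ψ) ^ 2 ≤ (2 + 1 / δ) + K * (lam * ψ + 1) := by
    have h1 := mul_le_mul_of_nonneg_left T7 (show 0 ≤ ψ ^ 2 / κ by positivity)
    have hfe : f = κ * H / α := by field_simp; linarith
    have h2 : ψ ^ 2 / κ * (κ * (1 / ψ ^ 2) * (2 + 1 / δ) + |α - 1| * f * lam
      + |α - 1| * f / ψ) = (2 + 1 / δ) + |α - 1| * H * ψ / α * (lam * ψ + 1) := by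
      rw [hfe]; field_simp; ring
    have h3 : |α - 1| * H * ψ / α ≤ K := by rw [hK]; gcongr
    have h4 : |α - 1| * H * ψ / α * (lam * ψ + 1) ≤ K * (lam * ψ + 1) := by gcongr
    have h5 : ψ ^ 2 / κ * (κ * (c ^ 2 / 4) * lam ^ 2) = c ^ 2 / 4 * (lam * ψ) ^ 2 := by field_simp
    rw [h2, h5] at h1
    linarith
  set y := lam * ψ with hy
  have hy0 : 0 < y := by positivity
  have haΛ : 0 ≤ a * Λ := by positivity
  have hlast : 0 ≤ 4 / c ^ 2 * (2 + 1 / δ + 2 * K) := by positivity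
  by_cases hy1 : y ≤ 1
  · linarith
  · push Not at hy1
    have h1 : c ^ 2 / 4 * y * y ≤ (2 + 1 / δ + 2 * K) * y := by
      have hd : 0 < 1 / δ := by positivity
      have k1 : (2 + 1 / δ) * 1 ≤ (2 + 1 / δ) * y := by gcongr
      have k2 : K * (y + 1) ≤ K * (2 * y) := by gcongr; linarith
      have k3 : c ^ 2 / 4 * y * y = c ^ 2 / 4 * y ^ 2 := by ring
      rw [k3]; linarith
    have h2 : c ^ 2 / 4 * y ≤ (2 + 1 / δ + 2 * K) := le_of_mul_le_mul_right h1 hy0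
    have h3 : y = 4 / c ^ 2 * (c ^ 2 / 4 * y) := by field_simp
    have h4 : 4 / c ^ 2 * (c ^ 2 / 4 * y) ≤ 4 / c ^ 2 * (2 + 1 / δ + 2 * K) := by gcongr
    linarith
end LCB
end part5

section part6
namespace LCB
open Matrix

theorem frame_exists {n : ℕ} (p : Fin n → ℝ) (r : Fin n → Fin n → ℝ) (hr : ∀ i j, r i j = r j i)
    (v : ℝ) (hv0 : 0 < v) (hv : v ^ 2 = 1 + ∑ i, p i ^ 2) :
    ∃ (R : Fin n → Fin n → ℝ) (L : Fin n → ℝ),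
      (∀ j k, ∑ a, R j a * R k a = (if j = k then 1 else 0) - p j * p k / v ^ 2) ∧
      (∀ a b, ∑ j, ∑ k, R j a * R k b * r j k = if a = b then v * L b else 0) ∧
      (∀ a b, ∑ j, R j a * R j b + (∑ j, p j * R j a) * (∑ j, p j * R j b)
        = if a = b then 1 else 0) := by
  have hpp : p ⬝ᵥ p = v ^ 2 - 1 := by rw [hv]; simp [dotProduct, pow_two]
  have hP2 : vecMulVec p p * vecMulVec p p = (v ^ 2 - 1) • vecMulVec p p := by
    rw [vecMulVec_mul_vecMulVec, hpp]
    ext i j; simp [vecMulVec_apply]; ring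
  set P := vecMulVec p p with hP
  have hPT : Pᵀ = P := by ext i j; simp [hP, vecMulVec_apply, mul_comm]
  set B : Matrix (Fin n) (Fin n) ℝ := 1 - (1 / (v * (v + 1))) • P with hB
  have hBT : Bᵀ = B := by rw [hB, transpose_sub, transpose_smul, hPT, transpose_one]
  have hBB : B * B = 1 - (1 / v ^ 2) • P := by
    rw [hB]
    simp only [sub_mul, mul_sub, one_mul, mul_one, smul_mul_assoc, mul_smul_comm, hP2]
    have : v + 1 ≠ 0 := by positivity
    ext i j
    simp only [Matrix.sub_apply, Matrix.smul_apply, smul_eq_mul]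
    field_simp
    ring
  set r' : Matrix (Fin n) (Fin n) ℝ := Matrix.of r with hr'
  have hrT : r'ᵀ = r' := by ext i j; simp [hr', hr i j]
  set M := (1 / v) • (B * r' * B) with hM
  have hMh : M.IsHermitian := by
    rw [IsHermitian, conjTranspose_eq_transpose_of_trivial, hM, transpose_smul, transpose_mul,
      transpose_mul, hBT, hrT, Matrix.mul_assoc]
  set O : Matrix (Fin n) (Fin n) ℝ := (hMh.eigenvectorUnitary : Matrix (Fin n) (Fin n) ℝ) with hO
  set L := hMh.eigenvalues with hL
  have hspec : M = O * diagonal L * Oᵀ := by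
    have := hMh.spectral_theorem
    simpa [Unitary.conjStarAlgAut_apply, star_eq_conjTranspose,
      conjTranspose_eq_transpose_of_trivial, Function.comp_def] using this
  have hOO : Oᵀ * O = 1 := by
    have := Unitary.coe_star_mul_self hMh.eigenvectorUnitary
    simpa [star_eq_conjTranspose, conjTranspose_eq_transpose_of_trivial] using this
  have hOO' : O * Oᵀ = 1 := mul_eq_one_comm.mp hOO
  set R := B * O with hR
  have hRT : Rᵀ = Oᵀ * B := by rw [hR, transpose_mul, hBT]
  have h1 : R * Rᵀ = 1 - (1 / v ^ 2) • P := by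
    rw [hRT, hR, ← hBB, Matrix.mul_assoc, ← Matrix.mul_assoc O, hOO', Matrix.one_mul]
  have h2 : Rᵀ * r' * R = v • diagonal L := by
    have e : B * r' * B = v • M := by rw [hM, smul_smul]; simp [hv0.ne']
    calc Rᵀ * r' * R = Oᵀ * (B * r' * B) * O := by rw [hRT, hR]; simp only [Matrix.mul_assoc]
      _ = v • ((Oᵀ * O) * diagonal L * (Oᵀ * O)) := by
        rw [e, hspec]; simp only [Matrix.mul_assoc, smul_mul_assoc, mul_smul_comm]
      _ = _ := by rw [hOO]; simp
  have h3 : Rᵀ * (1 + P) * R = 1 := by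
    rw [mul_eq_one_comm, ← Matrix.mul_assoc, h1]
    simp only [sub_mul, mul_add, one_mul, mul_one, smul_mul_assoc, hP2]
    ext i j
    simp only [Matrix.sub_apply, Matrix.add_apply, Matrix.smul_apply, smul_eq_mul]
    field_simp
    ring
  refine ⟨fun j a => R j a, L, ?_, ?_, ?_⟩
  · intro j k
    have := congrFun (congrFun h1 j) k
    simp only [mul_apply, transpose_apply, Matrix.sub_apply, Matrix.smul_apply, hP, vecMulVec_apply, one_apply,
      smul_eq_mul] at this
    rw [this]; ring
  · intro a b
    have := congrFun (congrFun h2 a) b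
    simp only [mul_apply, transpose_apply, Matrix.smul_apply, diagonal_apply, smul_eq_mul,
      Finset.sum_mul] at this
    rw [Finset.sum_comm]
    have e2 : (if a = b then v * L b else 0) = v * if a = b then L a else 0 := by
      split_ifs with h <;> simp [h]
    rw [e2, ← this]
    exact Finset.sum_congr rfl fun k _ => Finset.sum_congr rfl fun j _ => by
      simp [hr']; ring
  · intro a b
    have := congrFun (congrFun h3 a) b
    simp only [mul_add, add_mul, Matrix.mul_one, Matrix.add_apply, one_apply] at this
    rw [← this]
    congr 1
    rw [hP, mul_vecMulVec, vecMulVec_mul, vecMulVec_apply]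
    simp [mulVec, vecMul, dotProduct, mul_comm]

theorem fr_sig {n : ℕ} {p : Fin n → ℝ} {v : ℝ} (hv0 : 0 < v)
    (hv : v ^ 2 = 1 + ∑ i, p i ^ 2) {R : Fin n → Fin n → ℝ}
    (h1 : ∀ j k, ∑ a, R j a * R k a = (if j = k then 1 else 0) - p j * p k / v ^ 2)
    (j : Fin n) : ∑ a, (∑ k, p k * R k a) * R j a = p j / v ^ 2 := by
  have : ∑ a, (∑ k, p k * R k a) * R j a = ∑ k, p k * ∑ a, R k a * R j a := by
    simp only [Finset.sum_mul, Finset.mul_sum]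
    rw [Finset.sum_comm]
    exact Finset.sum_congr rfl fun k _ => Finset.sum_congr rfl fun a _ => by ring
  rw [this]
  have e : ∀ k, p k * ∑ a, R k a * R j a = p k * (if k = j then 1 else 0)
      - p j / v ^ 2 * p k ^ 2 := by
    intro k; rw [h1]; ring
  simp only [e, Finset.sum_sub_distrib, ← Finset.mul_sum]
  have : ∑ i, p i ^ 2 = v ^ 2 - 1 := by linarith
  rw [this]
  simp
  field_simp
  ring

theorem fr_sigsq {n : ℕ} {p : Fin n → ℝ} {v : ℝ} (hv0 : 0 < v)
    (hv : v ^ 2 = 1 + ∑ i, p i ^ 2) {R : Fin n → Fin n → ℝ}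
    (h1 : ∀ j k, ∑ a, R j a * R k a = (if j = k then 1 else 0) - p j * p k / v ^ 2)
    : ∑ a, (∑ k, p k * R k a) ^ 2 = 1 - 1 / v ^ 2 := by
  have : ∑ a, (∑ k, p k * R k a) ^ 2 = ∑ j, p j * ∑ a, (∑ k, p k * R k a) * R j a := by
    simp only [Finset.mul_sum]
    rw [Finset.sum_comm]
    refine Finset.sum_congr rfl fun a _ => ?_
    rw [pow_two]
    conv_lhs => rw [Finset.mul_sum]
    exact Finset.sum_congr rfl fun k _ => by ring
  rw [this]
  simp only [fr_sig hv0 hv h1]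
  have e : ∀ j, p j * (p j / v ^ 2) = 1 / v ^ 2 * p j ^ 2 := by intro j; ring
  simp only [e, ← Finset.mul_sum]
  have : ∑ i, p i ^ 2 = v ^ 2 - 1 := by linarith
  rw [this]; field_simp

/-- expansion of a vector in the frame -/
theorem fr_expand {n : ℕ} {p : Fin n → ℝ} {v : ℝ} (hv0 : 0 < v)
    (hv : v ^ 2 = 1 + ∑ i, p i ^ 2) {R : Fin n → Fin n → ℝ}
    (h1 : ∀ j k, ∑ a, R j a * R k a = (if j = k then 1 else 0) - p j * p k / v ^ 2)
    (ξ : Fin n → ℝ) (j : Fin n) :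
    ξ j = ∑ a, (∑ k, (ξ k + p k * ∑ l, p l * ξ l) * R k a) * R j a := by
  have : ∑ a, (∑ k, (ξ k + p k * ∑ l, p l * ξ l) * R k a) * R j a =
      ∑ k, (ξ k + p k * ∑ l, p l * ξ l) * ∑ a, R k a * R j a := by
    simp only [Finset.sum_mul, Finset.mul_sum]
    rw [Finset.sum_comm]
    exact Finset.sum_congr rfl fun k _ => Finset.sum_congr rfl fun a _ => by ring
  rw [this]
  set S := ∑ l, p l * ξ l with hS
  have e : ∀ k, (ξ k + p k * S) * ∑ a, R k a * R j a = (ξ k + p k * S) * (if k = j then 1 else 0)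
      - p j / v ^ 2 * (p k * ξ k) - p j * S / v ^ 2 * p k ^ 2 := by
    intro k; rw [h1]; ring
  simp only [e, Finset.sum_sub_distrib, ← Finset.mul_sum, ← hS]
  have : ∑ i, p i ^ 2 = v ^ 2 - 1 := by linarith
  rw [this]
  simp
  field_simp
  ring

theorem fr_rayleigh {n : ℕ} {p : Fin n → ℝ} {v : ℝ} (hv0 : 0 < v)
    (hv : v ^ 2 = 1 + ∑ i, p i ^ 2) {R : Fin n → Fin n → ℝ}
    (h1 : ∀ j k, ∑ a, R j a * R k a = (if j = k then 1 else 0) - p j * p k / v ^ 2)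
    {r : Fin n → Fin n → ℝ} {L : Fin n → ℝ}
    (h2 : ∀ a b, ∑ j, ∑ k, R j a * R k b * r j k = if a = b then v * L b else 0)
    (i : Fin n) (hi : ∀ a, L a ≤ L i) (ξ : Fin n → ℝ) :
    ∑ j, ∑ k, ξ j * ξ k * r j k ≤ v * L i * (∑ j, ξ j ^ 2 + (∑ j, p j * ξ j) ^ 2) := by
  set y : Fin n → ℝ := fun a => ∑ k, (ξ k + p k * ∑ l, p l * ξ l) * R k a with hy
  have hξ : ∀ j, ξ j = ∑ a, y a * R j a := fr_expand hv0 hv h1 ξ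
  have e1 : ∑ j, ∑ k, ξ j * ξ k * r j k = ∑ a, v * L a * y a ^ 2 := by
    have s1 : ∑ j, ∑ k, ξ j * ξ k * r j k =
        ∑ j, ∑ k, ∑ a, ∑ b, y a * y b * (R j a * R k b * r j k) := by
      refine Finset.sum_congr rfl fun j _ => Finset.sum_congr rfl fun k _ => ?_
      conv_lhs => rw [hξ j, hξ k]
      rw [Finset.sum_mul_sum, Finset.sum_mul]
      refine Finset.sum_congr rfl fun a _ => ?_
      rw [Finset.sum_mul]
      exact Finset.sum_congr rfl fun b _ => by ring
    have s2 : ∑ j, ∑ k, ∑ a, ∑ b, y a * y b * (R j a * R k b * r j k) =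
        ∑ a, ∑ b, y a * y b * ∑ j, ∑ k, R j a * R k b * r j k := by
      calc _ = ∑ j, ∑ a, ∑ k, ∑ b, y a * y b * (R j a * R k b * r j k) :=
            Finset.sum_congr rfl fun j _ => Finset.sum_comm
        _ = ∑ a, ∑ j, ∑ k, ∑ b, y a * y b * (R j a * R k b * r j k) := Finset.sum_comm
        _ = ∑ a, ∑ j, ∑ b, ∑ k, y a * y b * (R j a * R k b * r j k) :=
            Finset.sum_congr rfl fun a _ => Finset.sum_congr rfl fun j _ => Finset.sum_comm
        _ = ∑ a, ∑ b, ∑ j, ∑ k, y a * y b * (R j a * R k b * r j k) :=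
            Finset.sum_congr rfl fun a _ => Finset.sum_comm
        _ = _ := by simp only [Finset.mul_sum]
    rw [s1, s2]
    simp only [h2]
    refine Finset.sum_congr rfl fun a _ => ?_
    simp; ring
  have e2 : ∑ j, ξ j ^ 2 + (∑ j, p j * ξ j) ^ 2 = ∑ a, y a ^ 2 := by
    have s1 : ∑ a, y a ^ 2 = ∑ k, (ξ k + p k * ∑ l, p l * ξ l) * ∑ a, y a * R k a := by
      simp only [Finset.mul_sum (s := Finset.univ) (f := fun a => y a * R _ a)]
      rw [Finset.sum_comm]
      refine Finset.sum_congr rfl fun a _ => ?_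
      rw [pow_two]
      conv_lhs => enter [2]; rw [hy]
      simp only []
      rw [Finset.mul_sum]
      exact Finset.sum_congr rfl fun k _ => by ring
    rw [s1]
    simp only [← hξ, add_mul, Finset.sum_add_distrib]
    congr 1
    · exact Finset.sum_congr rfl fun k _ => by ring
    · rw [pow_two, Finset.sum_mul]
      exact Finset.sum_congr rfl fun k _ => by ring
  rw [e1, e2, Finset.mul_sum]
  refine Finset.sum_le_sum fun a _ => ?_
  have := hi a
  gcongr

theorem fr_trace {n : ℕ} {p : Fin n → ℝ} {v : ℝ}  {R : Fin n → Fin n → ℝ}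
    (h1 : ∀ j k, ∑ a, R j a * R k a = (if j = k then 1 else 0) - p j * p k / v ^ 2)
    {r : Fin n → Fin n → ℝ} {L : Fin n → ℝ}
    (h2 : ∀ a b, ∑ j, ∑ k, R j a * R k b * r j k = if a = b then v * L b else 0)
    : ∑ j, ∑ k, ((if j = k then (1:ℝ) else 0) - p j * p k / v ^ 2) * r j k
    = v * ∑ a, L a := by
  simp only [← h1]
  have : ∀ a, v * L a = ∑ j, ∑ k, R j a * R k a * r j k := by intro a; rw [h2]; simp
  simp only [Finset.mul_sum, this, Finset.sum_mul]
  rw [Finset.sum_comm_cycle]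

theorem fr_norm {n : ℕ} {p : Fin n → ℝ} {v : ℝ} (hv0 : 0 < v)
    {R : Fin n → Fin n → ℝ}
    (h1 : ∀ j k, ∑ a, R j a * R k a = (if j = k then 1 else 0) - p j * p k / v ^ 2)
    {r : Fin n → Fin n → ℝ} {L : Fin n → ℝ}
    (h2 : ∀ a b, ∑ j, ∑ k, R j a * R k b * r j k = if a = b then v * L b else 0)
    : ∑ i, ∑ j, ∑ k, ∑ l,
    ((if i = k then (1:ℝ) else 0) - p i * p k / (v ^ 2)) *
    ((if j = l then (1:ℝ) else 0) - p j * p l / (v ^ 2)) * (r i j / v) * (r k l / v)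
    = ∑ a, L a ^ 2 := by
  have e : ∀ a, L a ^ 2 = ∑ b, (∑ j, ∑ k, R j a * R k b * r j k) *
      (∑ j, ∑ k, R j a * R k b * r j k) / v ^ 2 := by
    intro a
    rw [Finset.sum_eq_single a]
    · rw [h2]; simp; field_simp
    · intro b _ hb; rw [h2, if_neg (Ne.symm hb)]; simp
    · simp
  simp only [e, ← h1]
  have s : ∀ a b, (∑ j, ∑ k, R j a * R k b * r j k) *
      (∑ j, ∑ k, R j a * R k b * r j k) / v ^ 2 =
      ∑ i, ∑ j, ∑ k, ∑ l, R i a * R k a * (R j b * R l b) * (r i j / v) * (r k l / v) := by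
    intro a b
    rw [Finset.sum_mul, Finset.sum_div]
    refine Finset.sum_congr rfl fun i _ => ?_
    rw [Finset.sum_mul, Finset.sum_div]
    refine Finset.sum_congr rfl fun j _ => ?_
    rw [Finset.mul_sum, Finset.sum_div]
    refine Finset.sum_congr rfl fun k _ => ?_
    rw [Finset.mul_sum, Finset.sum_div]
    refine Finset.sum_congr rfl fun l _ => ?_
    field_simp
  simp only [s]
  have s2 : ∀ i j k l, (∑ a, R i a * R k a) * (∑ a, R j a * R l a) * (r i j / v) * (r k l / v)
    = ∑ a, ∑ b, R i a * R k a * (R j b * R l b) * (r i j / v) * (r k l / v) := by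
    intro i j k l
    rw [Finset.sum_mul_sum]; simp only [Finset.sum_mul]
  simp only [s2]
  -- reorder
  set g : Fin n → Fin n → Fin n → Fin n → Fin n → Fin n → ℝ := fun i j k l a b =>
    R i a * R k a * (R j b * R l b) * (r i j / v) * (r k l / v) with hg
  change ∑ i, ∑ j, ∑ k, ∑ l, ∑ a, ∑ b, g i j k l a b = ∑ a, ∑ b, ∑ i, ∑ j, ∑ k, ∑ l, g i j k l a b
  calc _ = ∑ q : (Fin n × Fin n × Fin n × Fin n), ∑ w : Fin n × Fin n,
        g q.1 q.2.1 q.2.2.1 q.2.2.2 w.1 w.2 := by simp only [Fintype.sum_prod_type]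
    _ = ∑ w : Fin n × Fin n, ∑ q : (Fin n × Fin n × Fin n × Fin n),
        g q.1 q.2.1 q.2.2.1 q.2.2.2 w.1 w.2 := Finset.sum_comm
    _ = _ := by simp only [Fintype.sum_prod_type]


/-- comparison of the largest eigenvalue and the norm -/
theorem eig_compare {n : ℕ} (L : Fin n → ℝ) (i : Fin n) (hi : ∀ a, L a ≤ L i)
    (hs : 0 < ∑ a, L a) : 0 < L i ∧ L i ≤ Real.sqrt (∑ a, L a ^ 2) ∧
      Real.sqrt (∑ a, L a ^ 2) ≤ n ^ 2 * L i := by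
  have hn : (1:ℝ) ≤ n := by
    have := i.pos
    exact_mod_cast this
  have h1 : ∑ a, L a ≤ n * L i := by
    have := Finset.sum_le_sum (s := Finset.univ) (fun a _ => hi a)
    simpa using this
  have hLi : 0 < L i := by
    by_contra h
    push Not at h
    nlinarith
  refine ⟨hLi, ?_, ?_⟩
  · apply Real.le_sqrt_of_sq_le
    exact Finset.single_le_sum (f := fun b => L b ^ 2) (fun b _ => sq_nonneg _) (Finset.mem_univ i)
  · have habs : ∀ a, |L a| ≤ n * L i := by
      intro a
      rw [abs_le]
      constructor
      · have h2 : ∑ b ∈ Finset.univ.erase a, L b ≤ (n - 1) * L i := by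
          have := Finset.sum_le_sum (s := Finset.univ.erase a) (fun a _ => hi a)
          rw [Finset.sum_const, Finset.card_erase_of_mem (Finset.mem_univ a)] at this
          simp only [Finset.card_univ, Fintype.card_fin, nsmul_eq_mul] at this
          rwa [Nat.cast_sub i.pos, Nat.cast_one] at this
        have h3 := Finset.add_sum_erase Finset.univ L (Finset.mem_univ a)
        nlinarith
      · have := hi a
        nlinarith
    have h4 : ∑ a, L a ^ 2 ≤ (n ^ 2 * L i) ^ 2 := by
      calc ∑ a, L a ^ 2 ≤ ∑ a : Fin n, (n * L i) ^ 2 := by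
            refine Finset.sum_le_sum fun a _ => ?_
            exact sq_le_sq' (by have := (abs_le.1 (habs a)).1; linarith) (abs_le.1 (habs a)).2
        _ = n * (n * L i) ^ 2 := by simp
        _ ≤ n ^ 2 * (n * L i) ^ 2 := by gcongr; nlinarith
        _ = _ := by ring
    calc _ ≤ Real.sqrt ((n ^ 2 * L i) ^ 2) := Real.sqrt_le_sqrt h4
      _ = _ := Real.sqrt_sq (by positivity)
end LCB
end part6

section part7
namespace LCB
open Filter Topology
open scoped ContDiff

variable {Z : Type*} [NormedAddCommGroup Z] [NormedSpace ℝ Z]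

/-- change of orthonormal frame -/
theorem frame_change {n : ℕ} {W : Set Z} (hW : IsOpen W) {F : Z → ℝ} (hF : ContDiffOn ℝ ∞ F W)
    {ι : Type*} [Fintype ι] (E : Fin n → Z) (Q : ι → Fin n → ℝ)
    (hQ : ∀ j k, ∑ A, Q A j * Q A k = if j = k then 1 else 0) {z : Z} (hz : z ∈ W) :
    ∑ A, (D (∑ j, Q A j • E j) F z) ^ 2 = ∑ j, (D (E j) F z) ^ 2 ∧
    ∑ A, D (∑ j, Q A j • E j) (D (∑ j, Q A j • E j) F) z = ∑ j, D (E j) (D (E j) F) z ∧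
    ∑ A, ∑ B, D (∑ j, Q A j • E j) F z * D (∑ j, Q B j • E j) F z *
      D (∑ j, Q A j • E j) (D (∑ j, Q B j • E j) F) z =
    ∑ j, ∑ k, D (E j) F z * D (E k) F z * D (E j) (D (E k) F) z := by
  classical
  have key : ∀ g : Fin n → Fin n → ℝ, ∑ A, ∑ j, ∑ k, Q A j * Q A k * g j k = ∑ j, g j j := by
    intro g
    rw [Finset.sum_comm]
    have : ∀ j, ∑ A, ∑ k, Q A j * Q A k * g j k = g j j := by
      intro j
      rw [Finset.sum_comm]
      simp only [← Finset.sum_mul, hQ]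
      simp
    simp only [this]
  refine ⟨?_, ?_, ?_⟩
  · rw [← (key fun j k => D (E j) F z * D (E k) F z).trans
      (Finset.sum_congr rfl fun j _ => by ring)]
    refine Finset.sum_congr rfl fun A _ => ?_
    rw [D_sum, pow_two, Finset.sum_mul_sum]
    exact Finset.sum_congr rfl fun j _ => Finset.sum_congr rfl fun k _ => by ring
  · rw [← key fun j k => D (E j) (D (E k) F) z]
    exact Finset.sum_congr rfl fun A _ => (hess_contract hW hF hz _ _ _).symm
  · rw [hess_contract hW hF hz, hess_contract hW hF hz]
    have : ∑ A, D (∑ j, Q A j • E j) F z • (∑ j, Q A j • E j) = ∑ j, D (E j) F z • E j := by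
      simp only [D_sum, Finset.smul_sum, smul_smul, Finset.sum_mul]
      rw [Finset.sum_comm]
      refine Finset.sum_congr rfl fun k _ => ?_
      rw [← Finset.sum_smul]
      congr 1
      rw [Finset.sum_comm]
      have : ∀ j, ∑ A, Q A j * D (E j) F z * Q A k = (if j = k then 1 else 0) * D (E j) F z := by
        intro j; rw [← hQ, Finset.sum_mul]
        exact Finset.sum_congr rfl fun A _ => by ring
      simp only [this]
      simp
    rw [this]

theorem log_step {G1 G2 G3 A B N θ : ℝ} (h1 : 0 < G1) (h2 : 0 < G2) (h3 : 0 < G3) (hA : 0 < A)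
    (hN : 0 < N) (h : G1 / G2 * G3 ^ (-θ) * A ≤ N * B) :
    Real.log A - Real.log G2 - Real.log B - θ * Real.log G3 + Real.log G1 ≤ Real.log N := by
  have hp : 0 < G3 ^ (-θ) := Real.rpow_pos_of_pos h3 _
  have hl : 0 < G1 / G2 * G3 ^ (-θ) * A := by positivity
  have hB : 0 < B := by
    by_contra hB
    push Not at hB
    nlinarith
  have := Real.log_le_log hl h
  rw [Real.log_mul (by positivity) hA.ne', Real.log_mul (by positivity) hp.ne',
    Real.log_div h1.ne' h2.ne', Real.log_rpow h3, Real.log_mul hN.ne' hB.ne'] at this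
  linarith

theorem interior_bound (α a c : ℝ) (hα : 0 < α) (ha : 0 < a) (hc : 0 < c) (hc1 : c ≤ 1) :
    ∃ C : ℝ, 0 < C ∧ ∀ (n : ℕ) {W : Set Z} (_ : IsOpen W) {F v H f : Z → ℝ}
    (_ : ContDiffOn ℝ ∞ F W) (_ : ContDiffOn ℝ ∞ v W) (_ : ContDiffOn ℝ ∞ H W)
    (_ : ContDiffOn ℝ ∞ f W)
    (E : Fin n → Z) (τ : Z) (θ N : ℝ) (_ : θ = 1 - c ^ 2 / 8)
    (_ : ∀ z ∈ W, 0 < v z)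
    (_ : ∀ z ∈ W, v z ^ 2 = 1 + ∑ j, (D (E j) F z) ^ 2)
    (_ : ∀ z ∈ W, v z * H z * v z ^ 2 =
      v z ^ 2 * (∑ j, D (E j) (D (E j) F) z) -
      ∑ j, ∑ k, D (E j) F z * D (E k) F z * D (E j) (D (E k) F) z)
    (_ : ∀ z ∈ W, f z = H z ^ α) (_ : ∀ z ∈ W, D τ F z = v z * f z)
    (z : Z) (_ : z ∈ W) (_ : 0 < H z) (_ : 0 ≤ F z) (_ : F z < a)
    (_ : 2 * c ≤ f z) (_ : f z ≤ 2 / c) (_ : 0 < N)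
    (_ : ∀ y : Fin n → ℝ, ∀ᶠ s in 𝓝 (0:ℝ), ∀ z', z' = z + s • ∑ j, y j • E j → ∀ ξ : Fin n → ℝ,
      (a - F z') / v z' * (f z' - c) ^ (-θ) * ∑ j, ∑ k, ξ j * ξ k * D (E j) (D (E k) F) z' ≤
      N * (∑ j, ξ j ^ 2 + (∑ j, D (E j) F z' * ξ j) ^ 2))
    (_ : ∀ᶠ s in 𝓝[≤] (0:ℝ), ∀ z', z' = z + s • τ → ∀ ξ : Fin n → ℝ,
      (a - F z') / v z' * (f z' - c) ^ (-θ) * ∑ j, ∑ k, ξ j * ξ k * D (E j) (D (E k) F) z' ≤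
      N * (∑ j, ξ j ^ 2 + (∑ j, D (E j) F z * ξ j) ^ 2 - (∑ j, D (E j) F z * ξ j) ^ 2
        + (∑ j, D (E j) F z' * ξ j) ^ 2))
    (_ : ∃ ξ : Fin n → ℝ, 0 < ∑ j, ξ j ^ 2 + (∑ j, D (E j) F z * ξ j) ^ 2 ∧
      N * (∑ j, ξ j ^ 2 + (∑ j, D (E j) F z * ξ j) ^ 2) ≤
      (a - F z) / v z * (f z - c) ^ (-θ) * ∑ j, ∑ k, ξ j * ξ k * D (E j) (D (E k) F) z),
    N ≤ C * (f z - c) ^ (-θ) := by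
  obtain ⟨C, hC, hconst⟩ := const_bound α a c hα ha hc hc1
  refine ⟨C, hC, ?_⟩
  intro n W hW F v H f hF hv hH hf E τ θ N hθ hvp hV hE hfH hflow z hz hHz hF0 hFa hfl hfu hN
    hspace htime hex
  classical
  have hvz := hvp z hz
  have hv0 := hvz.ne'
  have hfc : 0 < f z - c := by linarith
  have hψ : 0 < a - F z := by linarith
  have hpos : 0 < (f z - c) ^ (-θ) := Real.rpow_pos_of_pos hfc _
  obtain ⟨R, L, h1, h2, h3⟩ := frame_exists (fun j => D (E j) F z)
    (fun j k => D (E j) (D (E k) F) z) (fun j k => D_comm hW hF _ _ hz) (v z) hvz (hV z hz)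
  -- top eigenvalue
  have hne : Nonempty (Fin n) := by
    by_contra hempty
    rw [not_nonempty_iff] at hempty
    obtain ⟨ξ, hξ, -⟩ := hex
    simp at hξ
  obtain ⟨i, -, hi⟩ := Finset.exists_max_image Finset.univ L ⟨hne.some, Finset.mem_univ _⟩
  have hi' : ∀ b, L b ≤ L i := fun b => hi b (Finset.mem_univ _)
  set e : Fin n → Z := fun b => ∑ j, R j b • E j with he
  set q : Fin n → ℝ := fun j => D (E j) F z / v z with hq
  set e0 : Z := ∑ j, q j • E j with he0
  set σ : Fin n → ℝ := fun b => ∑ j, D (E j) F z * R j b with hσ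
  have Dσ : ∀ b, D (e b) F z = σ b := by
    intro b; simp only [he, D_sum, hσ]; exact Finset.sum_congr rfl fun j _ => by ring
  have hsig : ∑ b, σ b ^ 2 = 1 - 1 / v z ^ 2 := fr_sigsq hvz (hV z hz) h1
  have he0' : e0 = v z • ∑ b, σ b • e b := by
    have : ∑ b, σ b • e b = ∑ j, (D (E j) F z / v z ^ 2) • E j := by
      simp only [he, Finset.smul_sum, smul_smul]
      rw [Finset.sum_comm]
      refine Finset.sum_congr rfl fun j _ => ?_
      rw [← Finset.sum_smul, ← fr_sig hvz (hV z hz) h1 j]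
    rw [this, he0, Finset.smul_sum]
    refine Finset.sum_congr rfl fun j _ => ?_
    rw [smul_smul]; congr 1; simp only [hq]; field_simp
  have hL : ∀ a b, D (e a) (D (e b) F) z = if a = b then v z * L b else 0 := by
    intro a b
    rw [← h2, hess_contract hW hF hz]
  -- frame change
  set Q : Option (Fin n) → Fin n → ℝ := fun A j => A.elim (q j) (fun b => R j b) with hQ
  have hQfr : ∀ A, fr e e0 A = ∑ j, Q A j • E j := by intro A; cases A <;> rfl
  have hQQ : ∀ j k, ∑ A, Q A j * Q A k = if j = k then 1 else 0 := by
    intro j k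
    rw [Fintype.sum_option]
    simp only [hQ, Option.elim]
    rw [h1]; simp only [hq]; field_simp; ring
  have fc := fun y (hy : y ∈ W) => frame_change hW hF E Q hQQ hy
  have hV' : ∀ z ∈ W, v z ^ 2 = 1 + ∑ A, (D (fr e e0 A) F z) ^ 2 := by
    intro y hy; simp only [hQfr]; rw [(fc y hy).1, hV y hy]
  have hE' : ∀ z ∈ W, v z * H z * v z ^ 2 =
      v z ^ 2 * (∑ A, D (fr e e0 A) (D (fr e e0 A) F) z) -
      ∑ A, ∑ B, D (fr e e0 A) F z * D (fr e e0 B) F z * D (fr e e0 A) (D (fr e e0 B) F) z := by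
    intro y hy; simp only [hQfr]; rw [(fc y hy).2.1, (fc y hy).2.2, hE y hy]
  -- N
  set G0 := (a - F z) / v z * (f z - c) ^ (-θ) with hG0
  have hG0p : 0 < G0 := by positivity
  have hNle : N ≤ G0 * (v z * L i) := by
    obtain ⟨ξ, hξ, hξ2⟩ := hex
    have hr := fr_rayleigh hvz (hV z hz) h1 h2 i hi' ξ
    have h4 : N * (∑ j, ξ j ^ 2 + (∑ j, D (E j) F z * ξ j) ^ 2) ≤ G0 * (v z * L i) *
        (∑ j, ξ j ^ 2 + (∑ j, D (E j) F z * ξ j) ^ 2) := by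
      exact hξ2.trans ((mul_le_mul_of_nonneg_left hr hG0p.le).trans (le_of_eq (by ring)))
    exact le_of_mul_le_mul_right h4 hξ
  have hvL : 0 < v z * L i := by
    by_contra h; push Not at h
    nlinarith
  have hlam : 0 < L i := by
    by_contra h; push Not at h
    nlinarith
  have hB1 : ∑ j, R j i ^ 2 = 1 - σ i ^ 2 := by
    have := h3 i i
    simp only [if_true, ← pow_two] at this
    simp only [hσ]; linarith
  have hNge : G0 * (v z * L i) ≤ N := by
    have := (hspace 0).self_of_nhds z (by simp) (fun j => R j i)
    have h5 := h2 i i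
    simp only [if_true] at h5
    have h6 : ∑ j, D (E j) F z * R j i = σ i := rfl
    simp only [h5, hB1, h6] at this
    linarith
  have hNeq : N = G0 * (v z * L i) := le_antisymm hNle hNge
  -- continuity
  have cont : ∀ (K : Z → ℝ), ContDiffOn ℝ ∞ K W → ∀ d, ContinuousAt (fun s : ℝ => K (z + s • d)) 0 :=
    fun K hK d => (line_jet hW hK hz d).hasDerivAt.continuousAt
  have evp : ∀ d, ∀ᶠ s in 𝓝 (0:ℝ), z + s • d ∈ W ∧ 0 < a - F (z + s • d) ∧
      0 < f (z + s • d) - c := by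
    intro d
    have c1 := cont F hF d
    have c2 := cont f hf d
    have k1 := c1.eventually (gt_mem_nhds (show F (z + (0:ℝ) • d) < a by simpa using hFa))
    have k2 := c2.eventually (lt_mem_nhds (show c < f (z + (0:ℝ) • d) by simp; linarith))
    filter_upwards [line_mem hW hz d, k1, k2] with s a1 a2 a3
    exact ⟨a1, by linarith, by linarith⟩
  have logN : Real.log N = Real.log (v z * L i) - Real.log (v z) - θ * Real.log (f z - c)
      + Real.log (a - F z) := by
    rw [hNeq, Real.log_mul hG0p.ne' hvL.ne', hG0, Real.log_mul (by positivity) hpos.ne',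
      Real.log_div hψ.ne' hv0, Real.log_rpow hfc]
    ring
  have hDii : D (e i) (D (e i) F) z = v z * L i := by rw [hL]; simp
  have hFsum : ∀ (z' : Z) (d : Fin n → ℝ), ∑ j, D (E j) F z' * d j = D (∑ j, d j • E j) F z' := by
    intro z' d; rw [D_sum]; exact Finset.sum_congr rfl fun j _ => by ring
  have main := local_key hW hF hv hH hf e e0 τ α θ c a hα hV' hE' hfH hflow hz hvz hHz L hL
    (by simpa only [Dσ] using he0') (by simpa only [Dσ] using hsig) i (L i) rfl hlam hfc hψ
    (by
      intro b μ _
      have cA : ContinuousAt (fun s : ℝ => D (e i) (D (e i) F) (z + s • e b)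
        - 2 * μ * s * D (e i) (D e0 F) (z + s • e b)
        + μ ^ 2 * s ^ 2 * D e0 (D e0 F) (z + s • e b)) 0 := by
        have k1 := cont _ (D_smooth hW (D_smooth hW hF (e i)) (e i)) (e b)
        have k2 := cont _ (D_smooth hW (D_smooth hW hF e0) (e i)) (e b)
        have k3 := cont _ (D_smooth hW (D_smooth hW hF e0) e0) (e b)
        fun_prop
      have hA := cA.eventually (lt_mem_nhds (a := 0) (by simpa [hDii] using hvL))
      filter_upwards [evp (e b), hspace (fun j => R j b), hA] with s ⟨k1, k2, k3⟩ k4 k5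
      have k6 := k4 (z + s • e b) rfl (fun j => R j i - μ * s * q j)
      have x1 : ∑ j, (R j i - μ * s * q j) • E j = e i + (-(μ * s)) • e0 := by
        simp only [he, he0, sub_smul, Finset.sum_sub_distrib, Finset.smul_sum, smul_smul]
        rw [sub_eq_add_neg, ← Finset.sum_neg_distrib]
        congr 1
        exact Finset.sum_congr rfl fun j _ => by rw [← neg_smul]; ring_nf
      have x2 : ∑ j, (R j i - μ * s * q j) ^ 2 = (1 - σ i ^ 2) - 2 * (μ * σ i / v z) * s
          + μ ^ 2 * (1 - 1 / v z ^ 2) * s ^ 2 := by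
        have y1 : ∀ j, (R j i - μ * s * q j) ^ 2 = R j i ^ 2
          - 2 * μ * s / v z * (D (E j) F z * R j i)
          + μ ^ 2 * s ^ 2 / v z ^ 2 * (D (E j) F z) ^ 2 := by
          intro j; simp only [hq]; field_simp; ring
        simp only [y1, Finset.sum_add_distrib, Finset.sum_sub_distrib, ← Finset.mul_sum, hB1]
        have y2 : ∑ j, (D (E j) F z) ^ 2 = v z ^ 2 - 1 := by rw [hV z hz]; ring
        rw [y2]; simp only [hσ]; field_simp
      rw [hess_contract hW hF k1, hFsum, x1, x2] at k6
      have x3 : D (e i + (-(μ * s)) • e0) (D (e i + (-(μ * s)) • e0) F) (z + s • e b) =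
        D (e i) (D (e i) F) (z + s • e b)
        - 2 * μ * s * D (e i) (D e0 F) (z + s • e b)
        + μ ^ 2 * s ^ 2 * D e0 (D e0 F) (z + s • e b) := by
        simp only [hess_add_right hW hF k1, hess_smul_right hW hF k1, D_add, D_smul]
        rw [D_comm hW hF e0 (e i) k1]; ring
      rw [x3, D_add, D_smul] at k6
      have k7 := log_step k2 (hvp _ k1) k3 k5 hN k6
      simp only [zero_smul, add_zero, mul_zero, zero_mul, sub_zero, ne_eq, OfNat.ofNat_ne_zero,
        not_false_eq_true, zero_pow, hDii, Dσ, sub_add_cancel, Real.log_one]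
      rw [← logN]
      refine le_trans (le_of_eq ?_) k7
      congr 6
      ring)
    (by
      have cA : ContinuousAt (fun s : ℝ => D (e i) (D (e i) F) (z + s • τ)) 0 :=
        cont _ (D_smooth hW (D_smooth hW hF (e i)) (e i)) τ
      have hA := cA.eventually (lt_mem_nhds (a := 0) (by simpa [hDii] using hvL))
      filter_upwards [nhdsWithin_le_nhds (evp τ), htime, nhdsWithin_le_nhds hA] with s ⟨k1, k2, k3⟩ k4 k5
      have k6 := k4 (z + s • τ) rfl (fun j => R j i)
      rw [hess_contract hW hF k1, hFsum (z + s • τ), add_sub_cancel_right, hB1] at k6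
      have k7 := log_step k2 (hvp _ k1) k3 k5 hN k6
      simp only [hDii, Dσ, sub_add_cancel, Real.log_one, sub_zero]
      rw [← logN]
      exact k7)
  obtain ⟨f1, κ, hκ, hineq⟩ := main
  have hv1 : 1 ≤ v z := by
    have := hV z hz
    have h7 : 0 ≤ ∑ j, (D (E j) F z) ^ 2 := Finset.sum_nonneg fun j _ => sq_nonneg _
    nlinarith
  have hfin := hconst n i (H z) (f z) κ (v z) (a - F z) (L i) L (fun b => D (e b) F z) f1 θ hθ hHz
    (hfH z hz) hκ hv1 hψ (by linarith) rfl hlam hfl hfu (by simpa only [Dσ] using hsig) hineq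
  calc N = L i * (a - F z) * (f z - c) ^ (-θ) := by rw [hNeq, hG0]; field_simp
    _ ≤ C * (f z - c) ^ (-θ) := by gcongr
end LCB
end part7

section part8
namespace LCB
open Filter Topology
open scoped ContDiff

section slice
variable {n : ℕ}

/-- coordinate vector -/
def ev (i : Fin n) : En n := EuclideanSpace.single i 1

theorem pd_eq_D (f : En n → ℝ) (i : Fin n) : pd f i = D (ev i) f := rfl

theorem line0 {Z : Type*} [NormedAddCommGroup Z] [NormedSpace ℝ Z] {W : Set Z} (hW : IsOpen W)
    {G : Z → ℝ} (hG : ContDiffOn ℝ ∞ G W) {z : Z} (hz : z ∈ W) (d : Z) :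
    HasDerivAt (fun r : ℝ => G (z + r • d)) (D d G z) 0 := by
  simpa using line_hasDerivAt hW hG z d 0 (by simpa using hz)

theorem graphV_sq (f : En n → ℝ) (x : En n) : graphV f x ^ 2 = 1 + ∑ i, pd f i x ^ 2 := by
  unfold graphV gradNormSq
  rw [Real.sq_sqrt]
  have : 0 ≤ ∑ i, pd f i x ^ 2 := Finset.sum_nonneg fun _ _ => sq_nonneg _
  linarith

theorem graphV_ge (f : En n → ℝ) (x : En n) : 1 ≤ graphV f x := by
  unfold graphV gradNormSq
  rw [Real.one_le_sqrt]
  have : 0 ≤ ∑ i, pd f i x ^ 2 := Finset.sum_nonneg fun _ _ => sq_nonneg _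
  linarith

theorem graphV_pos (f : En n → ℝ) (x : En n) : 0 < graphV f x :=
  lt_of_lt_of_le one_pos (graphV_ge f x)

theorem graphV_smooth {U : Set (En n)} (hU : IsOpen U) {f : En n → ℝ} (hf : ContDiffOn ℝ ∞ f U) :
    ContDiffOn ℝ ∞ (graphV f) U := by
  have : ContDiffOn ℝ ∞ (fun x => 1 + ∑ i, pd f i x ^ 2) U :=
    contDiffOn_const.add (ContDiffOn.sum fun i _ => (D_smooth hU hf (ev i)).pow 2)
  refine this.sqrt ?_
  intro x _
  have : 0 ≤ ∑ i, pd f i x ^ 2 := Finset.sum_nonneg fun _ _ => sq_nonneg _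
  linarith

theorem meanCurv_formula {U : Set (En n)} (hU : IsOpen U) {f : En n → ℝ}
    (hf : ContDiffOn ℝ ∞ f U) {x : En n} (hx : x ∈ U) :
    graphV f x * meanCurv f x * graphV f x ^ 2 =
      graphV f x ^ 2 * (∑ j, pd (fun y => pd f j y) j x) -
      ∑ j, ∑ k, pd f j x * pd f k x * pd (fun y => pd f k y) j x := by
  have hv := graphV_smooth hU hf
  have hfi := fun i => D_smooth hU hf (ev i)
  have hv0 := (graphV_pos f x).ne'
  have e1 : ∀ i, graphV f x * D (ev i) (graphV f) x = ∑ k, pd f k x * pd (fun y => pd f k y) i x := by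
    intro i
    have k1 := (line0 hU hv hx (ev i)).pow 2
    have k2 : HasDerivAt (fun r : ℝ => 1 + ∑ k, (D (ev k) f (x + r • ev i)) ^ 2)
        (∑ k, 2 * D (ev k) f x * D (ev i) (D (ev k) f) x) 0 := by
      refine HasDerivAt.const_add _ (HasDerivAt.fun_sum fun k _ => ?_)
      simpa using (line0 hU (hfi k) hx (ev i)).fun_pow 2
    have k3 := k1.unique (k2.congr_of_eventuallyEq (Eventually.of_forall fun r => graphV_sq f _))
    simp only [zero_smul, add_zero, Nat.cast_ofNat, mul_assoc, ← Finset.mul_sum] at k3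
    simp only [pd_eq_D] at *
    simp at k3
    linarith
  have e2 : ∀ i, pd (fun y => pd f i y / graphV f y) i x =
      (pd (fun y => pd f i y) i x * graphV f x - pd f i x * D (ev i) (graphV f) x)
        / graphV f x ^ 2 := by
    intro i
    have k1 := (line0 hU (hfi i) hx (ev i)).div (line0 hU hv hx (ev i)) (by simpa using hv0)
    have k2 := line0 hU ((hfi i).div hv fun y _ => (graphV_pos f y).ne') hx (ev i)
    have := k2.unique k1
    simp only [zero_smul, add_zero] at this
    exact this
  have e3 : graphV f x * meanCurv f x * graphV f x ^ 2 =
    ∑ i, (graphV f x ^ 2 * pd (fun y => pd f i y) i x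
      - pd f i x * (graphV f x * D (ev i) (graphV f) x)) := by
    unfold meanCurv
    rw [Finset.mul_sum, Finset.sum_mul]
    refine Finset.sum_congr rfl fun i _ => ?_
    rw [e2]; field_simp
  rw [e3, Finset.sum_sub_distrib, Finset.mul_sum]
  congr 1
  refine Finset.sum_congr rfl fun i _ => ?_
  rw [e1, Finset.mul_sum]
  exact Finset.sum_congr rfl fun k _ => by ring

theorem pd_symm {U : Set (En n)} (hU : IsOpen U) {f : En n → ℝ}
    (hf : ContDiffOn ℝ ∞ f U) {x : En n} (hx : x ∈ U) (i j : Fin n) :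
    pd (fun y => pd f j y) i x = pd (fun y => pd f i y) j x := D_comm hU hf _ _ hx

/-- Hessian quadratic form -/
def hq (f : En n → ℝ) (x : En n) (ξ : Fin n → ℝ) : ℝ :=
  ∑ j, ∑ k, ξ j * ξ k * pd (fun y => pd f k y) j x
/-- metric quadratic form -/
def gq (f : En n → ℝ) (x : En n) (ξ : Fin n → ℝ) : ℝ :=
  ∑ j, ξ j ^ 2 + (∑ j, pd f j x * ξ j) ^ 2

theorem max_eig {U : Set (En n)} (hU : IsOpen U) {f : En n → ℝ}
    (hf : ContDiffOn ℝ ∞ f U) {x : En n} (hx : x ∈ U) (hH : 0 < meanCurv f x) :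
    ∃ lam : ℝ, 0 < lam ∧ lam ≤ normA f x ∧ normA f x ≤ n ^ 2 * lam ∧
      (∃ ξ, gq f x ξ = 1 ∧ hq f x ξ = graphV f x * lam) ∧
      ∀ ξ, hq f x ξ ≤ graphV f x * lam * gq f x ξ := by
  have hv0 := graphV_pos f x
  have hv := graphV_sq f x
  obtain ⟨R, L, h1, h2, h3⟩ := frame_exists (fun j => pd f j x)
    (fun j k => pd (fun y => pd f k y) j x) (fun i j => pd_symm hU hf hx i j) _ hv0 hv
  have hHL : meanCurv f x = ∑ b, L b := by
    have k1 := fr_trace h1 h2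
    have k2 := meanCurv_formula hU hf hx
    have k3 : ∑ j, ∑ k, ((if j = k then (1:ℝ) else 0) - pd f j x * pd f k x / graphV f x ^ 2)
        * pd (fun y => pd f k y) j x = ∑ j, pd (fun y => pd f j y) j x
        - (∑ j, ∑ k, pd f j x * pd f k x * pd (fun y => pd f k y) j x) / graphV f x ^ 2 := by
      rw [Finset.sum_div, ← Finset.sum_sub_distrib]
      refine Finset.sum_congr rfl fun j _ => ?_
      simp only [sub_mul, Finset.sum_sub_distrib, Finset.sum_div]
      congr 1
      · simp
      · exact Finset.sum_congr rfl fun k _ => by ring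
    rw [k3] at k1
    have k4 : graphV f x ^ 3 * meanCurv f x = graphV f x ^ 3 * ∑ b, L b := by
      have : graphV f x ^ 2 * (∑ j, pd (fun y => pd f j y) j x
        - (∑ j, ∑ k, pd f j x * pd f k x * pd (fun y => pd f k y) j x) / graphV f x ^ 2) =
        graphV f x ^ 2 * (∑ j, pd (fun y => pd f j y) j x)
        - (∑ j, ∑ k, pd f j x * pd f k x * pd (fun y => pd f k y) j x) := by
        field_simp
      rw [k1] at this
      linarith
    exact mul_left_cancel₀ (by positivity) k4
  have hA : normA f x = Real.sqrt (∑ b, L b ^ 2) := by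
    rw [← fr_norm hv0 h1 h2]
    unfold normA ginv sff
    rw [hv]; rfl
  have hne : Nonempty (Fin n) := by
    by_contra hempty
    rw [not_nonempty_iff] at hempty
    rw [hHL] at hH
    simp at hH
  obtain ⟨i, -, hi⟩ := Finset.exists_max_image Finset.univ L ⟨hne.some, Finset.mem_univ _⟩
  have hi' : ∀ b, L b ≤ L i := fun b => hi b (Finset.mem_univ _)
  obtain ⟨a1, a2, a3⟩ := eig_compare L i hi' (hHL ▸ hH)
  refine ⟨L i, a1, hA ▸ a2, hA ▸ a3, ⟨fun j => R j i, ?_, ?_⟩, fr_rayleigh hv0 hv h1 h2 i hi'⟩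
  · have := h3 i i
    simp only [if_true, ← pow_two] at this
    exact this
  · have := h2 i i
    simp only [if_true] at this
    exact this
end slice

section product
variable {n : ℕ}

/-- partial derivative on space-time -/
def Pd (i : Fin n) (G : En n × ℝ → ℝ) : En n × ℝ → ℝ := fun z => pd (fun y => G (y, z.2)) i z.1

/-- coordinate vector in space-time -/
def Ev (i : Fin n) : En n × ℝ := (ev i, 0)

theorem slice_smooth {U : Set (En n)} {T : ℝ} {G : En n × ℝ → ℝ}
    (hG : ContDiffOn ℝ ∞ G (U ×ˢ Icc 0 T)) {t : ℝ} (ht : t ∈ Icc 0 T) :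
    ContDiffOn ℝ ∞ (fun y => G (y, t)) U :=
  hG.comp (contDiff_id.prodMk contDiff_const).contDiffOn fun _ hy => ⟨hy, ht⟩

theorem Pd_eq_within {U : Set (En n)} (hU : IsOpen U) {T : ℝ} {G : En n × ℝ → ℝ}
    (hG : ContDiffOn ℝ ∞ G (U ×ˢ Icc 0 T)) (i : Fin n) {z : En n × ℝ} (hz : z ∈ U ×ˢ Icc 0 T) :
    Pd i G z = fderivWithin ℝ G (U ×ˢ Icc 0 T) z (Ev i) := by
  have h1 := (hG.differentiableOn (by simp) z hz).hasFDerivWithinAt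
  have h2 : HasFDerivWithinAt (fun y : En n => (y, z.2)) (ContinuousLinearMap.inl ℝ (En n) ℝ) U z.1 :=
    (hasFDerivAt_prodMk_left z.1 z.2).hasFDerivWithinAt
  have h3 := (HasFDerivWithinAt.comp (g := G) z.1 (t := U ×ˢ Icc 0 T) h1 h2
    (fun y hy => ⟨hy, hz.2⟩)).hasFDerivAt (hU.mem_nhds hz.1)
  have h4 : fderiv ℝ (fun y => G (y, z.2)) z.1 = _ := h3.fderiv
  unfold Pd pd
  rw [h4]
  simp [Ev, ev]

theorem Pd_smooth {U : Set (En n)} (hU : IsOpen U) {T : ℝ} (hT : 0 < T) {G : En n × ℝ → ℝ}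
    (hG : ContDiffOn ℝ ∞ G (U ×ˢ Icc 0 T)) (i : Fin n) :
    ContDiffOn ℝ ∞ (Pd i G) (U ×ˢ Icc 0 T) := by
  have hu : UniqueDiffOn ℝ (U ×ˢ Icc 0 T) := hU.uniqueDiffOn.prod (uniqueDiffOn_Icc hT)
  exact ((hG.fderivWithin hu (m := ∞) (by simp)).clm_apply contDiffOn_const).congr
    fun z hz => Pd_eq_within hU hG i hz

theorem Pd_eq_D {W : Set (En n × ℝ)} (hW : IsOpen W) {G : En n × ℝ → ℝ}
    (hG : ContDiffOn ℝ ∞ G W) (i : Fin n) : EqOn (Pd i G) (D (Ev i) G) W := by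
  intro z hz
  have h1 := ((hG.contDiffAt (hW.mem_nhds hz)).differentiableAt (by simp)).hasFDerivAt
  have h2 : HasFDerivAt (fun y : En n => (y, z.2)) (ContinuousLinearMap.inl ℝ (En n) ℝ) z.1 :=
    (hasFDerivAt_prodMk_left z.1 z.2)
  have h3 := HasFDerivAt.comp (g := G) z.1 h1 h2
  have h4 : fderiv ℝ (fun y => G (y, z.2)) z.1 = _ := h3.fderiv
  unfold Pd pd D
  rw [h4]
  simp [Ev, ev]

end product
end LCB
end part8

section part9
namespace LCB
open Filter Topology
open scoped ContDiff

section product2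
variable {n : ℕ}

/-- area element on space-time -/
def Vf (F : En n × ℝ → ℝ) (z : En n × ℝ) : ℝ := graphV (fun y => F (y, z.2)) z.1
/-- mean curvature on space-time -/
def Hf (F : En n × ℝ → ℝ) (z : En n × ℝ) : ℝ := meanCurv (fun y => F (y, z.2)) z.1

theorem Vf_pos (F : En n × ℝ → ℝ) (z) : 0 < Vf F z := graphV_pos _ _

theorem Vf_smooth {U : Set (En n)} (hU : IsOpen U) {T : ℝ} (hT : 0 < T) {F : En n × ℝ → ℝ}
    (hF : ContDiffOn ℝ ∞ F (U ×ˢ Icc 0 T)) : ContDiffOn ℝ ∞ (Vf F) (U ×ˢ Icc 0 T) := by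
  have : ContDiffOn ℝ ∞ (fun z => 1 + ∑ i, Pd i F z ^ 2) (U ×ˢ Icc 0 T) :=
    contDiffOn_const.add (ContDiffOn.sum fun i _ => (Pd_smooth hU hT hF i).pow 2)
  refine this.sqrt ?_
  intro x _
  have : 0 ≤ ∑ i, Pd i F x ^ 2 := Finset.sum_nonneg fun _ _ => sq_nonneg _
  linarith

theorem Hf_smooth {U : Set (En n)} (hU : IsOpen U) {T : ℝ} (hT : 0 < T) {F : En n × ℝ → ℝ}
    (hF : ContDiffOn ℝ ∞ F (U ×ˢ Icc 0 T)) : ContDiffOn ℝ ∞ (Hf F) (U ×ˢ Icc 0 T) := by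
  have : ContDiffOn ℝ ∞ (fun z => ∑ i, Pd i (fun z => Pd i F z / Vf F z) z) (U ×ˢ Icc 0 T) :=
    ContDiffOn.sum fun i _ => Pd_smooth hU hT
      ((Pd_smooth hU hT hF i).div (Vf_smooth hU hT hF) fun z _ => (Vf_pos F z).ne') i
  exact this

theorem normA_cont {U : Set (En n)} (hU : IsOpen U) {T : ℝ} (hT : 0 < T) {F : En n × ℝ → ℝ}
    (hF : ContDiffOn ℝ ∞ F (U ×ˢ Icc 0 T)) :
    ContinuousOn (fun z : En n × ℝ => normA (fun y => F (y, z.2)) z.1) (U ×ˢ Icc 0 T) := by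
  have c1 := fun i => (Pd_smooth hU hT hF i).continuousOn
  have c2 := fun i j => (Pd_smooth hU hT (Pd_smooth hU hT hF j) i).continuousOn
  have c3 := (Vf_smooth hU hT hF).continuousOn
  have g : ∀ i j, ContinuousOn (fun z : En n × ℝ => ginv (fun y => F (y, z.2)) i j z.1)
      (U ×ˢ Icc 0 T) := by
    intro i j
    have h0 : ∀ z, (1 + ∑ i, Pd i F z ^ 2) ≠ 0 := by
      intro z
      have : 0 ≤ ∑ i, Pd i F z ^ 2 := Finset.sum_nonneg fun _ _ => sq_nonneg _
      positivity
    have : ContinuousOn (fun z => (if i = j then (1:ℝ) else 0) -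
      Pd i F z * Pd j F z / (1 + ∑ i, Pd i F z ^ 2)) (U ×ˢ Icc 0 T) :=
      continuousOn_const.sub (((c1 i).mul (c1 j)).div
        (continuousOn_const.add (continuousOn_finset_sum _ fun k _ => (c1 k).pow 2)) fun z _ => h0 z)
    exact this
  have s : ∀ i j, ContinuousOn (fun z : En n × ℝ => sff (fun y => F (y, z.2)) i j z.1)
      (U ×ˢ Icc 0 T) := fun i j => (c2 i j).div c3 fun z _ => (Vf_pos F z).ne'
  exact (continuousOn_finset_sum _ fun i _ => continuousOn_finset_sum _ fun j _ =>
    continuousOn_finset_sum _ fun k _ => continuousOn_finset_sum _ fun l _ =>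
    (((g i k).mul (g j l)).mul (s i j)).mul (s k l)).sqrt

theorem time_mono {T a : ℝ} {g : ℝ → ℝ} (hg : ContDiffOn ℝ ∞ g (Icc 0 T)) 
    (hd : ∀ s ∈ Icc 0 T, g s < a + 1 → 0 < deriv g s) {t : ℝ} (ht : t ∈ Icc 0 T) (hta : g t ≤ a) :
    g 0 ≤ a := by
  by_contra h
  push Not at h
  obtain ⟨b, hb1, hb2⟩ := exists_between (lt_min h (lt_add_one a))
  rw [lt_min_iff] at hb2
  have hsub : Icc 0 t ⊆ Icc 0 T := Icc_subset_Icc_right ht.2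
  have := image_le_of_deriv_right_lt_deriv_boundary' (f := fun s => - g s) (a := 0) (b := t)
    (f' := fun s => - derivWithin g (Icc 0 T) s) (B := fun _ => -b) (B' := fun _ => 0)
    ((hg.continuousOn.mono hsub).neg)
    (by
      intro s hs
      have h1 := (hg.differentiableOn (by simp) s (hsub ⟨hs.1, hs.2.le⟩)).hasDerivWithinAt
      refine (h1.mono_of_mem_nhdsWithin ?_).neg
      exact mem_of_superset (Icc_mem_nhdsGE (hs.2.trans_le ht.2)) (Icc_subset_Icc_left hs.1))
    (by simpa using hb2.1.le) continuousOn_const (fun s _ => hasDerivWithinAt_const _ _ _)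
    (by
      intro s hs hsb
      have hgb : g s = b := by linarith
      have h1 := hd s (hsub ⟨hs.1, hs.2.le⟩) (by linarith)
      have h2 : DifferentiableAt ℝ g s := by
        by_contra h3
        rw [deriv_zero_of_not_differentiableAt h3] at h1
        exact lt_irrefl _ h1
      have hT : (0:ℝ) < T := by linarith [hs.1, hs.2, ht.2]
      rw [h2.derivWithin (uniqueDiffOn_Icc hT s (hsub ⟨hs.1, hs.2.le⟩))]
      linarith)
    (right_mem_Icc.2 ht.1)
  linarith

theorem hq_smul (f : En n → ℝ) (x : En n) (s : ℝ) (ξ : Fin n → ℝ) :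
    hq f x (fun j => s * ξ j) = s ^ 2 * hq f x ξ := by
  unfold hq
  simp only [Finset.mul_sum]
  exact Finset.sum_congr rfl fun j _ => Finset.sum_congr rfl fun k _ => by ring

theorem gq_smul (f : En n → ℝ) (x : En n) (s : ℝ) (ξ : Fin n → ℝ) :
    gq f x (fun j => s * ξ j) = s ^ 2 * gq f x ξ := by
  unfold gq
  have : ∑ j, pd f j x * (s * ξ j) = s * ∑ j, pd f j x * ξ j := by
    rw [Finset.mul_sum]; exact Finset.sum_congr rfl fun j _ => by ring
  have h2 : ∑ j, (s * ξ j) ^ 2 = s ^ 2 * ∑ j, ξ j ^ 2 := by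
    rw [Finset.mul_sum]; exact Finset.sum_congr rfl fun j _ => by ring
  simp only [this, h2]
  ring

theorem sphere_ext (f : En n → ℝ) (x : En n) (G N : ℝ)
    (h : ∀ ξ ∈ Metric.sphere (0 : En n) 1, G * hq f x ξ / gq f x ξ ≤ N) (η : Fin n → ℝ) :
    G * hq f x η ≤ N * gq f x η := by
  by_cases h0 : ∑ j, η j ^ 2 = 0
  · have : ∀ j, η j = 0 := by
      intro j
      have := (Finset.sum_eq_zero_iff_of_nonneg fun j _ => sq_nonneg (η j)).1 h0 j (Finset.mem_univ _)
      simpa using this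
    have : η = fun j => 0 * (0 : Fin n → ℝ) j := by funext j; simp [this j]
    rw [this, hq_smul, gq_smul]; simp
  · have hpos : 0 < ∑ j, η j ^ 2 :=
      lt_of_le_of_ne (Finset.sum_nonneg fun _ _ => sq_nonneg _) (Ne.symm h0)
    set s := Real.sqrt (∑ j, η j ^ 2) with hs
    have hs0 : 0 < s := Real.sqrt_pos.2 hpos
    have hss : s ^ 2 = ∑ j, η j ^ 2 := Real.sq_sqrt hpos.le
    set ξ : En n := WithLp.toLp 2 (fun j => s⁻¹ * η j) with hξ
    have hn : ∑ j, ξ j ^ 2 = 1 := by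
      simp only [hξ, mul_pow, ← Finset.mul_sum, ← hss]
      field_simp
    have hmem : ξ ∈ Metric.sphere (0 : En n) 1 := by
      rw [mem_sphere_zero_iff_norm]
      rw [EuclideanSpace.norm_eq]
      simp [hn]
    have hη : η = fun j => s * ξ j := by
      funext j; simp only [hξ]; field_simp
    have hgp : 0 < gq f x ξ := by
      unfold gq; rw [hn]; positivity
    have := h ξ hmem
    rw [div_le_iff₀ hgp] at this
    rw [hη, hq_smul, gq_smul]
    nlinarith [sq_nonneg s]

end product2
end LCB
end part9

section part10
namespace LCB
open Filter Topology
open scoped ContDiff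

section global
variable {n : ℕ}

theorem K_compact {U : Set (En n)} {T a : ℝ} {F : En n × ℝ → ℝ}
    (hF : ContDiffOn ℝ ∞ F (U ×ˢ Icc 0 T))
    (hK0 : IsCompact {x ∈ U | F (x, 0) ≤ a})
    (hd : ∀ x ∈ U, ∀ t ∈ Icc 0 T, F (x, t) < a + 1 → 0 < deriv (fun s => F (x, s)) t)
    {T' : ℝ} (hT' : T' ≤ T) : IsCompact {z | z ∈ U ×ˢ Icc 0 T' ∧ F z ≤ a} := by
  have hc : IsCompact ({x ∈ U | F (x, 0) ≤ a} ×ˢ Icc 0 T') := hK0.prod isCompact_Icc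
  have hsub : {x ∈ U | F (x, 0) ≤ a} ×ˢ Icc 0 T' ⊆ U ×ˢ Icc 0 T :=
    prod_mono (fun x hx => hx.1) (Icc_subset_Icc_right hT')
  have hcl := (hF.continuousOn.mono hsub).preimage_isClosed_of_isClosed hc.isClosed
    (isClosed_Iic (a := a))
  have heq : {z | z ∈ U ×ˢ Icc 0 T' ∧ F z ≤ a} =
      {x ∈ U | F (x, 0) ≤ a} ×ˢ Icc 0 T' ∩ F ⁻¹' Iic a := by
    ext z
    constructor
    · rintro ⟨⟨h1, h2⟩, h3⟩
      refine ⟨⟨⟨h1, ?_⟩, h2⟩, h3⟩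
      have ht : z.2 ∈ Icc 0 T := Icc_subset_Icc_right hT' h2
      refine time_mono (g := fun s => F (z.1, s)) (T := T) ?_ (hd z.1 h1) ht h3
      exact hF.comp (contDiff_const.prodMk contDiff_id).contDiffOn fun _ hy => ⟨h1, hy⟩
    · rintro ⟨⟨h1, h2⟩, h3⟩
      exact ⟨⟨h1.1, h2⟩, h3⟩
  rw [heq]
  exact hc.of_isClosed_subset hcl inter_subset_left

/-- weight function -/
def Gw (α a c θ : ℝ) (F : En n × ℝ → ℝ) (z : En n × ℝ) : ℝ :=
  (a - F z) / Vf F z * (max (Hf F z ^ α) (2 * c) - c) ^ (-θ)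

theorem max_exists {U : Set (En n)} (hU : IsOpen U) {T : ℝ} (hT : 0 < T) {α a c θ : ℝ}
    (hα : 0 < α) (hc : 0 < c) {F : En n × ℝ → ℝ}
    (hF : ContDiffOn ℝ ∞ F (U ×ˢ Icc 0 T)) {K : Set (En n × ℝ)} (hK : IsCompact K)
    (hKS : K ⊆ U ×ˢ Icc 0 T) (hKn : K.Nonempty) (hn : 1 ≤ n) :
    ∃ z0 ∈ K, ∃ N : ℝ, (∀ z ∈ K, ∀ ξ, Gw α a c θ F z * hq (fun y => F (y, z.2)) z.1 ξ ≤
        N * gq (fun y => F (y, z.2)) z.1 ξ) ∧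
      ∃ ξ, 0 < gq (fun y => F (y, z0.2)) z0.1 ξ ∧ N * gq (fun y => F (y, z0.2)) z0.1 ξ
        = Gw α a c θ F z0 * hq (fun y => F (y, z0.2)) z0.1 ξ := by
  have cF := hF.continuousOn.mono hKS
  have c1 := fun i => (Pd_smooth hU hT hF i).continuousOn.mono hKS
  have c2 := fun i j => (Pd_smooth hU hT (Pd_smooth hU hT hF j) i).continuousOn.mono hKS
  have cV := (Vf_smooth hU hT hF).continuousOn.mono hKS
  have cH := (Hf_smooth hU hT hF).continuousOn.mono hKS
  have cG : ContinuousOn (Gw α a c θ F) K := by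
    refine ((continuousOn_const.sub cF).div cV fun z _ => (Vf_pos F z).ne').mul ?_
    refine ContinuousOn.rpow_const (((cH.rpow_const fun z _ => Or.inr hα.le).sup
      continuousOn_const).sub continuousOn_const) ?_
    intro z _
    left
    have := le_max_right (Hf F z ^ α) (2 * c)
    have : c ≤ max (Hf F z ^ α) (2 * c) - c := by linarith
    exact (hc.trans_le this).ne'
  set Sp := Metric.sphere (0 : En n) 1
  have hfst : MapsTo (fun q : (En n × ℝ) × En n => q.1) (K ×ˢ Sp) K := fun q hq => hq.1
  have f1 : ContinuousOn (fun q : (En n × ℝ) × En n => q.1) (K ×ˢ Sp) := continuous_fst.continuousOn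
  have fξ : ∀ j, ContinuousOn (fun q : (En n × ℝ) × En n => q.2 j) (K ×ˢ Sp) := by
    intro j
    have : Continuous (fun q : (En n × ℝ) × En n => q.2 j) := by fun_prop
    exact this.continuousOn
  have chq : ContinuousOn (fun q : (En n × ℝ) × En n => hq (fun y => F (y, q.1.2)) q.1.1 q.2)
      (K ×ˢ Sp) := continuousOn_finset_sum _ fun j _ => continuousOn_finset_sum _ fun k _ =>
    ((fξ j).mul (fξ k)).mul ((c2 j k).comp f1 hfst)
  have cgq : ContinuousOn (fun q : (En n × ℝ) × En n => gq (fun y => F (y, q.1.2)) q.1.1 q.2)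
      (K ×ˢ Sp) := (continuousOn_finset_sum _ fun j _ => (fξ j).pow 2).add
    ((continuousOn_finset_sum _ fun j _ => ((c1 j).comp f1 hfst).mul (fξ j)).pow 2)
  have gpos : ∀ q : (En n × ℝ) × En n, q ∈ K ×ˢ Sp → 0 < gq (fun y => F (y, q.1.2)) q.1.1 q.2 := by
    intro q hq
    have h1 : ‖q.2‖ = 1 := mem_sphere_zero_iff_norm.1 hq.2
    have h2 : ∑ j, q.2 j ^ 2 = 1 := by
      have := EuclideanSpace.real_norm_sq_eq q.2
      rw [h1] at this; linarith
    unfold gq; rw [h2]; positivity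
  have cΦ : ContinuousOn (fun q : (En n × ℝ) × En n => Gw α a c θ F q.1 *
      hq (fun y => F (y, q.1.2)) q.1.1 q.2 / gq (fun y => F (y, q.1.2)) q.1.1 q.2) (K ×ˢ Sp) :=
    ((cG.comp f1 hfst).mul chq).div cgq fun q hq => (gpos q hq).ne'
  have hSn : Sp.Nonempty := ⟨EuclideanSpace.single ⟨0, hn⟩ 1, by simp [Sp]⟩
  obtain ⟨q0, hq0, hmax⟩ := (hK.prod (isCompact_sphere (0 : En n) 1)).exists_isMaxOn
    (hKn.prod hSn) cΦ
  refine ⟨q0.1, hq0.1, _, ?_, q0.2, gpos q0 hq0, div_mul_cancel₀ _ (gpos q0 hq0).ne'⟩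
  intro z hz ξ
  refine sphere_ext _ _ _ _ (fun η hη => ?_) ξ
  exact hmax (show (z, η) ∈ K ×ˢ Sp from ⟨hz, hη⟩)

end global
end LCB
end part10

section part11
namespace LCB
open Filter Topology
open scoped ContDiff

theorem bound_lt (n : ℕ) (hn : 1 ≤ n) (α a c : ℝ) (hα : 0 < α) (ha : 0 < a) (hc : 0 < c)
    (hc1 : c ≤ 1) : ∃ C : ℝ, 0 < C ∧ ∀ (T : ℝ) (_ : 0 < T) (U : Set (En n)) (_ : IsOpen U)
    (F : En n × ℝ → ℝ) (_ : ContDiffOn ℝ ∞ F (U ×ˢ Icc 0 T))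
    (_ : ∀ z ∈ U ×ˢ Icc 0 T, 0 ≤ F z)
    (_ : IsCompact {x ∈ U | F (x, 0) ≤ a})
    (_ : ∀ x ∈ U, ∀ t ∈ Icc 0 T, F (x, t) < a + 1 → 0 < Hf F (x, t) ∧
      deriv (fun s => F (x, s)) t = Vf F (x, t) * Hf F (x, t) ^ α)
    (_ : ∀ z ∈ U ×ˢ Icc 0 T, F z < a → 2 * c ≤ Hf F z ^ α ∧ Hf F z ^ α ≤ 2 / c)
    (M : ℝ) (_ : ∀ y ∈ U, F (y, 0) < a → (a - F (y, 0)) * normA (fun y => F (y, 0)) y ≤ M)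
    (x : En n) (_ : x ∈ U) (t : ℝ) (_ : t ∈ Ico 0 T) (_ : F (x, t) < a),
    (a - F (x, t)) * normA (fun y => F (y, t)) x ≤ C * max M 1 := by
  obtain ⟨C', hC', hinter⟩ := interior_bound (Z := En n × ℝ) α a c hα ha hc hc1
  set θ : ℝ := 1 - c ^ 2 / 8 with hθ
  have hθ0 : 0 < θ := by nlinarith
  set Cf : ℝ := n ^ 2 * ((2 / c) ^ θ * (c ^ (-θ) * (max 1 C'))) with hCf
  have hCfp : 0 < Cf := by
    have h0 : (0:ℝ) < n := by exact_mod_cast hn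
    have : 0 < max 1 C' := lt_max_of_lt_left one_pos
    positivity
  refine ⟨Cf, hCfp, ?_⟩
  intro T hT U hU F hF hF0 hK0 hflow hfb M hM x hx t ht hFxt
  have hd : ∀ x ∈ U, ∀ t ∈ Icc 0 T, F (x, t) < a + 1 → 0 < deriv (fun s => F (x, s)) t := by
    intro x hx t ht h
    obtain ⟨h1, h2⟩ := hflow x hx t ht h
    rw [h2]
    exact mul_pos (Vf_pos _ _) (Real.rpow_pos_of_pos h1 _)
  have hts : t ∈ Icc 0 T := ⟨ht.1, ht.2.le⟩
  set K : Set (En n × ℝ) := {z | z ∈ U ×ˢ Icc 0 t ∧ F z ≤ a} with hKdef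
  have hK : IsCompact K := K_compact hF hK0 hd ht.2.le
  have hKS : K ⊆ U ×ˢ Icc 0 T := fun z hz => ⟨hz.1.1, hz.1.2.1, hz.1.2.2.trans ht.2.le⟩
  have hxK : (x, t) ∈ K := ⟨⟨hx, ht.1, le_rfl⟩, hFxt.le⟩
  obtain ⟨z0, hz0K, N, hNle, ξ0, hξ0, hNξ⟩ := max_exists (θ := θ) hU hT hα hc hF hK hKS ⟨_, hxK⟩ hn
    (a := a)
  have hGw : ∀ z ∈ U ×ˢ Icc 0 T, F z < a → Gw α a c θ F z =
      (a - F z) / Vf F z * (Hf F z ^ α - c) ^ (-θ) := by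
    intro z hz h
    unfold Gw; rw [max_eq_left (hfb z hz h).1]
  have hHp : ∀ z ∈ U ×ˢ Icc 0 T, F z < a → 0 < Hf F z :=
    fun z hz h => (hflow z.1 hz.1 z.2 hz.2 (by linarith [show F (z.1, z.2) = F z from rfl])).1
  -- lower bound for N
  obtain ⟨lam, l1, l2, l3, ⟨ξ, l4, l5⟩, l6⟩ := max_eig hU (slice_smooth hF hts) hx
    (hHp (x, t) ⟨hx, hts⟩ hFxt)
  have hfxt := hfb (x, t) ⟨hx, hts⟩ hFxt
  have hfc : 0 < Hf F (x, t) ^ α - c := by linarith [hfxt.1]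
  have hlow : (a - F (x, t)) * lam * (Hf F (x, t) ^ α - c) ^ (-θ) ≤ N := by
    have := hNle (x, t) hxK ξ
    rw [l4, l5, hGw _ ⟨hx, hts⟩ hFxt] at this
    have hv : Vf F (x, t) = graphV (fun y => F (y, t)) x := rfl
    have hv0 := Vf_pos F (x, t)
    rw [← hv] at this
    calc _ = (a - F (x, t)) / Vf F (x, t) * (Hf F (x, t) ^ α - c) ^ (-θ) * (Vf F (x, t) * lam) := by
            field_simp
      _ ≤ _ := by linarith
  have hψ : 0 < a - F (x, t) := by linarith
  have hrp := Real.rpow_pos_of_pos hfc (-θ)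
  have hN : 0 < N := lt_of_lt_of_le (by positivity) hlow
  -- facts at z0
  have hz0S := hKS hz0K
  have hFz0 : F z0 < a := by
    refine lt_of_le_of_ne hz0K.2 fun h => ?_
    have : Gw α a c θ F z0 = 0 := by unfold Gw; rw [h]; simp
    rw [this, zero_mul] at hNξ
    exact (mul_pos hN hξ0).ne' hNξ
  have hf0 := hfb z0 hz0S hFz0
  have hfc0 : 0 < Hf F z0 ^ α - c := by linarith [hf0.1]
  have hpow0 : (Hf F z0 ^ α - c) ^ (-θ) ≤ c ^ (-θ) :=
    Real.rpow_le_rpow_of_nonpos hc (by linarith [hf0.1]) (by linarith)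
  have hrp0 := Real.rpow_pos_of_pos hfc0 (-θ)
  have hcp := Real.rpow_pos_of_pos hc (-θ)
  have hM1 : 1 ≤ max M 1 := le_max_right _ _
  have hC1 : 1 ≤ max 1 C' := le_max_left _ _
  have hupper : N ≤ c ^ (-θ) * (max 1 C' * max M 1) := by
    rcases eq_or_lt_of_le hz0S.2.1 with h0 | h0
    · -- initial time
      obtain ⟨lam0, m1, m2, m3, -, m6⟩ := max_eig hU (slice_smooth hF hz0S.2) hz0S.1
        (hHp z0 hz0S hFz0)
      have hv : Vf F z0 = graphV (fun y => F (y, z0.2)) z0.1 := rfl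
      have hv0 := Vf_pos F z0
      have k1 : N ≤ (a - F z0) * lam0 * (Hf F z0 ^ α - c) ^ (-θ) := by
        refine le_of_mul_le_mul_right ?_ hξ0
        rw [hNξ, hGw z0 hz0S hFz0]
        have hψ0 : 0 < a - F z0 := by linarith
        calc _ ≤ (a - F z0) / Vf F z0 * (Hf F z0 ^ α - c) ^ (-θ) * (Vf F z0 * lam0 *
              gq (fun y => F (y, z0.2)) z0.1 ξ0) :=
              mul_le_mul_of_nonneg_left (m6 ξ0) (by positivity)
          _ = _ := by field_simp
      have k2 : (a - F z0) * normA (fun y => F (y, z0.2)) z0.1 ≤ M := by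
        have hz : z0 = (z0.1, 0) := by rw [h0]
        have := hM z0.1 hz0S.1 (by rw [← hz]; exact hFz0)
        rw [← hz] at this
        rw [← h0]; exact this
      have k3 : (a - F z0) * lam0 ≤ max M 1 :=
        ((mul_le_mul_of_nonneg_left m2 (by linarith)).trans k2).trans (le_max_left _ _)
      calc N ≤ (a - F z0) * lam0 * (Hf F z0 ^ α - c) ^ (-θ) := k1
        _ ≤ max M 1 * c ^ (-θ) := by gcongr
        _ ≤ c ^ (-θ) * (max 1 C' * max M 1) := by
          rw [mul_comm]; gcongr; nlinarith
    · -- interior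
      set W : Set (En n × ℝ) := (U ×ˢ Ioo 0 T) ∩ F ⁻¹' Iio (a + 1) with hWdef
      have hWS : W ⊆ U ×ˢ Icc 0 T := fun z hz => ⟨hz.1.1, hz.1.2.1.le, hz.1.2.2.le⟩
      have hW : IsOpen W := (hF.continuousOn.mono (prod_mono le_rfl Ioo_subset_Icc_self)
        ).isOpen_inter_preimage (hU.prod isOpen_Ioo) isOpen_Iio
      have hz0W : z0 ∈ W := ⟨⟨hz0S.1, h0, hz0K.1.2.2.trans_lt ht.2⟩, by
        show F z0 < a + 1
        linarith⟩
      have sF := hF.mono hWS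
      have sV := (Vf_smooth hU hT hF).mono hWS
      have sH := (Hf_smooth hU hT hF).mono hWS
      have hHW : ∀ z ∈ W, 0 < Hf F z := fun z hz => (hflow z.1 hz.1.1 z.2 (hWS hz).2 hz.2).1
      have sf : ContDiffOn ℝ ∞ (fun z => Hf F z ^ α) W :=
        sH.rpow_const_of_ne fun z hz => (hHW z hz).ne'
      have e1 : ∀ z ∈ W, ∀ j, pd (fun y => F (y, z.2)) j z.1 = D (Ev j) F z :=
        fun z hz j => Pd_eq_D hW sF j hz
      have e2 : ∀ z ∈ W, ∀ j k, pd (fun y => pd (fun y => F (y, z.2)) k y) j z.1 =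
          D (Ev j) (D (Ev k) F) z := by
        intro z hz j k
        have h1 := Pd_eq_D hW ((Pd_smooth hU hT hF k).mono hWS) j hz
        have h2 := D_congr hW (Pd_eq_D hW sF k) (Ev j) hz
        exact h1.trans h2
      have ehq : ∀ z ∈ W, ∀ ξ, hq (fun y => F (y, z.2)) z.1 ξ =
          ∑ j, ∑ k, ξ j * ξ k * D (Ev j) (D (Ev k) F) z := by
        intro z hz ξ; unfold hq; simp only [e2 z hz]
      have egq : ∀ z ∈ W, ∀ ξ, gq (fun y => F (y, z.2)) z.1 ξ =
          ∑ j, ξ j ^ 2 + (∑ j, D (Ev j) F z * ξ j) ^ 2 := by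
        intro z hz ξ; unfold gq; simp only [e1 z hz]
      have hVW : ∀ z ∈ W, Vf F z ^ 2 = 1 + ∑ j, (D (Ev j) F z) ^ 2 := by
        intro z hz; unfold Vf; rw [graphV_sq]; simp only [e1 z hz]
      have hEW : ∀ z ∈ W, Vf F z * Hf F z * Vf F z ^ 2 =
          Vf F z ^ 2 * (∑ j, D (Ev j) (D (Ev j) F) z) -
          ∑ j, ∑ k, D (Ev j) F z * D (Ev k) F z * D (Ev j) (D (Ev k) F) z := by
        intro z hz
        have := meanCurv_formula hU (slice_smooth hF (hWS hz).2) hz.1.1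
        simp only [e1 z hz, e2 z hz] at this
        exact this
      have hfl : ∀ z ∈ W, D ((0, 1) : En n × ℝ) F z = Vf F z * Hf F z ^ α := by
        intro z hz
        have h1 := (hflow z.1 hz.1.1 z.2 (hWS hz).2 hz.2).2
        rw [show Vf F z * Hf F z ^ α = Vf F (z.1, z.2) * Hf F (z.1, z.2) ^ α from rfl, ← h1]
        have h2 := ((sF.contDiffAt (hW.mem_nhds hz)).differentiableAt (by simp)).hasFDerivAt
        have h3 : HasDerivAt (fun s : ℝ => (z.1, s)) ((0, 1) : En n × ℝ) z.2 :=
          (hasDerivAt_const z.2 z.1).prodMk (hasDerivAt_id z.2)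
        exact (HasFDerivAt.comp_hasDerivAt (l := F) z.2 h2 h3).deriv.symm
      have good : ∀ z' ∈ W, F z' < a → z'.2 ≤ t → ∀ ξ : Fin n → ℝ,
          (a - F z') / Vf F z' * (Hf F z' ^ α - c) ^ (-θ) *
            ∑ j, ∑ k, ξ j * ξ k * D (Ev j) (D (Ev k) F) z' ≤
          N * (∑ j, ξ j ^ 2 + (∑ j, D (Ev j) F z' * ξ j) ^ 2) := by
        intro z' hz' hF' ht' ξ
        have := hNle z' ⟨⟨hz'.1.1, hz'.1.2.1.le, ht'⟩, hF'.le⟩ ξ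
        rw [hGw z' (hWS hz') hF', ehq z' hz', egq z' hz'] at this
        exact this
      have ev : ∀ d : En n × ℝ, ∀ᶠ s in 𝓝 (0:ℝ), z0 + s • d ∈ W ∧ F (z0 + s • d) < a := by
        intro d
        have c1 : ContinuousAt (fun s : ℝ => F (z0 + s • d)) 0 :=
          (line0 hW sF hz0W d).continuousAt
        filter_upwards [line_mem hW hz0W d, c1.eventually (gt_mem_nhds
          (show F (z0 + (0:ℝ) • d) < a by simpa using hFz0))] with s h1 h2 using ⟨h1, h2⟩
      have := hinter n hW sF sV sH sf Ev (0, 1) θ N hθ (fun z _ => Vf_pos F z) hVW hEW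
        (fun _ _ => rfl) hfl z0 hz0W (hHW z0 hz0W) (hF0 z0 hz0S) hFz0 hf0.1 hf0.2 hN
        (by
          intro y
          filter_upwards [ev (∑ j, y j • Ev j)] with s hs z' hz' ξ
          subst hz'
          refine good _ hs.1 hs.2 ?_ ξ
          have : (∑ j, y j • (Ev j : En n × ℝ)).2 = 0 := by
            rw [Prod.snd_sum]; simp [Ev]
          rw [Prod.snd_add, Prod.smul_snd, this]
          simpa using hz0K.1.2.2)
        (by
          filter_upwards [nhdsWithin_le_nhds (ev (0, 1)), self_mem_nhdsWithin] with s hs hs0 z' hz' ξ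
          subst hz'
          rw [add_sub_cancel_right]
          refine good _ hs.1 hs.2 ?_ ξ
          have h1 : s ≤ 0 := hs0
          have h2 := hz0K.1.2.2
          simp
          linarith)
        ⟨ξ0, by rw [← egq z0 hz0W]; exact hξ0, by
          rw [← egq z0 hz0W, ← ehq z0 hz0W, hNξ, hGw z0 hz0S hFz0]⟩
      calc N ≤ C' * (Hf F z0 ^ α - c) ^ (-θ) := this
        _ ≤ max 1 C' * c ^ (-θ) := by gcongr; exact le_max_right _ _
        _ ≤ c ^ (-θ) * (max 1 C' * max M 1) := by
          rw [mul_comm]; gcongr; nlinarith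
  -- conclusion
  have hpw : (Hf F (x, t) ^ α - c) ^ θ ≤ (2 / c) ^ θ :=
    Real.rpow_le_rpow hfc.le (by linarith [hfxt.2]) hθ0.le
  have hmul : (Hf F (x, t) ^ α - c) ^ (-θ) * (Hf F (x, t) ^ α - c) ^ θ = 1 := by
    rw [← Real.rpow_add hfc]; simp
  have hl : (a - F (x, t)) * lam ≤ N * (2 / c) ^ θ := by
    calc (a - F (x, t)) * lam = (a - F (x, t)) * lam * (Hf F (x, t) ^ α - c) ^ (-θ) *
          (Hf F (x, t) ^ α - c) ^ θ := by rw [mul_assoc, hmul, mul_one]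
      _ ≤ N * (2 / c) ^ θ := by gcongr
  calc (a - F (x, t)) * normA (fun y => F (y, t)) x ≤ (a - F (x, t)) * (n ^ 2 * lam) := by gcongr
    _ = n ^ 2 * ((a - F (x, t)) * lam) := by ring
    _ ≤ n ^ 2 * (N * (2 / c) ^ θ) := by gcongr
    _ ≤ n ^ 2 * ((c ^ (-θ) * (max 1 C' * max M 1)) * (2 / c) ^ θ) := by gcongr
    _ = Cf * max M 1 := by rw [hCf]; ring

end LCB
end part11

/-- Localized curvature bound for the graphical `H^α`-flow (with
`b = 0`), with a constant depending only on `n`, `α`, `a`, `c`, `w̲`. -/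
theorem localized_curvature_bound (n : ℕ) (hn : 1 ≤ n) (α a wlow c : ℝ)
    (hα : 0 < α) (ha : 0 < a) (hwlow : wlow ∈ Set.Ioc (0:ℝ) (1/2))
    (hc : c ∈ Set.Ioc (0:ℝ) 1) :
    ∃ C : ℝ, 0 < C ∧
      ∀ T : ℝ, 0 < T → ∀ U : Set (En n), IsOpen U → ∀ u : En n → ℝ → ℝ,
        ContDiffOn ℝ (⊤ : ℕ∞) (fun p : En n × ℝ => u p.1 p.2) (U ×ˢ Set.Icc 0 T) →
        (∀ x ∈ U, ∀ t ∈ Set.Icc (0:ℝ) T, 0 ≤ u x t) →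
        (∀ t ∈ Set.Icc (0:ℝ) T, IsCompact {x ∈ U | u x t ≤ a}) →
        (∀ x ∈ U, ∀ t ∈ Set.Icc (0:ℝ) T, u x t < a + 1 →
          0 < meanCurv (fun y => u y t) x ∧
          deriv (u x) t = graphV (fun y => u y t) x * meanCurv (fun y => u y t) x ^ α) →
        (∀ x ∈ U, ∀ t ∈ Set.Icc (0:ℝ) T, 0 < psiF a 0 u x t →
          2 * wlow ≤ wF u x t ∧
          c ≤ (1/2) * meanCurv (fun y => u y t) x ^ α ∧
          (1/2) * meanCurv (fun y => u y t) x ^ α ≤ c⁻¹) →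
        ∀ x ∈ U, ∀ t ∈ Set.Icc (0:ℝ) T, 0 < psiF a 0 u x t →
          psiF a 0 u x t * normA (fun y => u y t) x ≤
            C * max (sSup ((fun y => psiF a 0 u y 0 * normA (fun z => u z 0) y) ''
                {y ∈ U | 0 < psiF a 0 u y 0})) 1 := by
  obtain ⟨hc0, hc1⟩ := hc
  obtain ⟨C, hC, hb⟩ := LCB.bound_lt n hn α a c hα ha hc0 hc1
  refine ⟨C, hC, ?_⟩
  intro T hT U hU u hu hu0 hcomp hflow hbd x hx t ht hψ
  set F : En n × ℝ → ℝ := fun p => u p.1 p.2 with hFdef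
  have h0T : (0:ℝ) ∈ Icc 0 T := ⟨le_rfl, hT.le⟩
  have hpsi : ∀ y s, u y s < a → psiF a 0 u y s = a - F (y, s) := by
    intro y s h
    unfold psiF
    rw [max_eq_left (by linarith)]
    simp [hFdef]
  have hpos : ∀ y s, 0 < psiF a 0 u y s ↔ u y s < a := by
    intro y s
    unfold psiF
    simp
  have hcA := LCB.normA_cont hU hT hu
  have hcΨ : ContinuousOn (fun z : En n × ℝ => (a - F z) * normA (fun y => F (y, z.2)) z.1)
      (U ×ˢ Icc 0 T) := (continuousOn_const.sub hu.continuousOn).mul hcA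
  set M := sSup ((fun y => psiF a 0 u y 0 * normA (fun z => u z 0) y) ''
                {y ∈ U | 0 < psiF a 0 u y 0}) with hM
  have hMb : ∀ y ∈ U, F (y, 0) < a → (a - F (y, 0)) * normA (fun y => F (y, 0)) y ≤ M := by
    intro y hy hya
    refine le_csSup ?_ ⟨y, ⟨hy, (hpos y 0).2 hya⟩, ?_⟩
    · have hcc : ContinuousOn (fun y : En n => (a - F (y, 0)) * normA (fun y => F (y, 0)) y)
          {x ∈ U | u x 0 ≤ a} :=
        hcΨ.comp (f := fun y : En n => (y, (0:ℝ)))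
          (Continuous.continuousOn (by fun_prop)) (fun y hy => ⟨hy.1, h0T⟩)
      obtain ⟨B, hB⟩ := (hcomp 0 h0T).bddAbove_image hcc
      refine ⟨B, ?_⟩
      rintro _ ⟨y, ⟨hy, hy2⟩, rfl⟩
      have hy3 := (hpos y 0).1 hy2
      simp only
      rw [hpsi y 0 hy3]
      exact hB ⟨y, ⟨hy, hy3.le⟩, rfl⟩
    · simp only
      rw [hpsi y 0 hya]
  have hfb : ∀ z ∈ U ×ˢ Icc 0 T, F z < a → 2 * c ≤ LCB.Hf F z ^ α ∧ LCB.Hf F z ^ α ≤ 2 / c := by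
    intro z hz hza
    obtain ⟨-, h1, h2⟩ := hbd z.1 hz.1 z.2 hz.2 ((hpos _ _).2 hza)
    have e : LCB.Hf F z = meanCurv (fun y => u y z.2) z.1 := rfl
    rw [e]
    refine ⟨by linarith, ?_⟩
    rw [div_eq_mul_inv]; linarith
  have key := hb T hT U hU F hu (fun z hz => hu0 z.1 hz.1 z.2 hz.2) (hcomp 0 h0T)
    (fun x hx t ht h => hflow x hx t ht h) hfb M hMb
  have hxa := (hpos x t).1 hψ
  rw [hpsi x t hxa]
  rcases lt_or_eq_of_le ht.2 with htT | htT
  · exact key x hx t ⟨ht.1, htT⟩ hxa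
  · subst htT
    have hmaps : MapsTo (fun s : ℝ => (x, s)) (Ico 0 t) (U ×ˢ Icc 0 t) :=
      fun s hs => ⟨hx, hs.1, hs.2.le⟩
    have hpc : ContinuousWithinAt (fun s : ℝ => (x, s)) (Ico 0 t) t :=
      Continuous.continuousWithinAt (by fun_prop)
    have c1 : ContinuousWithinAt (fun s : ℝ => (a - F (x, s)) * normA (fun y => F (y, s)) x)
        (Ico 0 t) t := ContinuousWithinAt.comp (t := U ×ˢ Icc 0 t)
          (g := fun z : En n × ℝ => (a - F z) * normA (fun y => F (y, z.2)) z.1)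
          (f := fun s : ℝ => (x, s)) (hcΨ (x, t) ⟨hx, ht⟩) hpc hmaps
    have c2 : ContinuousWithinAt (fun s : ℝ => F (x, s)) (Ico 0 t) t :=
      ContinuousWithinAt.comp (t := U ×ˢ Icc 0 t) (g := F)
          (f := fun s : ℝ => (x, s)) (hu.continuousOn (x, t) ⟨hx, ht⟩) hpc hmaps
    have hne : (nhdsWithin t (Ico 0 t)).NeBot := by
      rw [← mem_closure_iff_nhdsWithin_neBot, closure_Ico hT.ne]
      exact ht
    refine le_of_tendsto c1 ?_
    filter_upwards [c2.eventually (gt_mem_nhds (show F (x, t) < a from hxa)),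
      self_mem_nhdsWithin] with s hs hs2
    exact key x hx s hs2 hs
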